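/- arXiv:1809.09811 — 8 statements merged into one kernel-verified Lean document; each statement's English description precedes it below -/
import Mathlib

section
/- Let n ≥ 3 and let G be the alternating group of degree n. Then: (i) two distinct odd primes p and q dividing |G| are adjacent in the prime graph GK(G) if and only if p + q ≤ n; (ii) for an odd prime p dividing |G|, the primes 2 and p are adjacent in GK(G) if and only if 4 + p ≤ n. -/
/-- The prime (Gruenberg–Kegel) graph of a finite group `G`, as a graph on `ℕ`:
distinct primes `r`, `s` are adjacent iff `G` has an element of order `r * s`. -/
def primeGraph (G : Type*) [Group G] : SimpleGraph ℕ where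
  Adj r s := r ≠ s ∧ r.Prime ∧ s.Prime ∧ ∃ g : G, orderOf g = r * s
  symm := by
    constructor
    rintro r s ⟨hne, hr, hs, g, hg⟩
    exact ⟨hne.symm, hs, hr, g, by rwa [Nat.mul_comm] at hg⟩
  loopless := by constructor; rintro r ⟨hne, _⟩; exact hne rfl

/-- A prime dividing the order of a permutation divides the length of one of its cycles. -/
theorem exists_mem_cycleType_of_prime_dvd_orderOf {α : Type*} [Fintype α] [DecidableEq α]
    {σ : Equiv.Perm α} {p : ℕ} (hp : p.Prime) (h : p ∣ orderOf σ) :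
    ∃ a ∈ σ.cycleType, p ∣ a := by
  rw [← Equiv.Perm.lcm_cycleType] at h
  have key : p ∣ σ.cycleType.prod :=
    h.trans (Multiset.lcm_dvd.2 fun _ hb => Multiset.dvd_prod hb)
  exact hp.prime.exists_mem_multiset_dvd key

/-- If an even permutation has a cycle of even length, then it has a second one. -/
theorem exists_even_mem_of_sign_eq_one {α : Type*} [Fintype α] [DecidableEq α]
    {σ : Equiv.Perm α} (hσ : Equiv.Perm.sign σ = 1) {a : ℕ} {m : Multiset ℕ}
    (hm : σ.cycleType = a ::ₘ m) (ha : Even a) : ∃ b ∈ m, Even b := by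
  by_contra! hodd
  have hprod : (m.map fun k => -(-1 : ℤˣ) ^ k).prod = 1 :=
    Multiset.prod_eq_one fun x hx => by
      obtain ⟨b, hb, rfl⟩ := Multiset.mem_map.1 hx
      simp [(Nat.not_even_iff_odd.1 (hodd b hb)).neg_one_pow]
  rw [Equiv.Perm.sign_of_cycleType', hm, Multiset.map_cons, Multiset.prod_cons, hprod,
    ha.neg_one_pow] at hσ
  exact absurd hσ (by decide)

/-- A multiset of integers at least `2` with sum at most `n` and even sign is the cycle type
of an element of the alternating group of degree `n`, whose order is then the `lcm`. -/
theorem exists_alternatingGroup_orderOf_eq_lcm {n : ℕ} {m : Multiset ℕ} (hsum : m.sum ≤ n)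
    (htwo : ∀ a ∈ m, 2 ≤ a) (heven : Even (m.sum + m.card)) :
    ∃ g : alternatingGroup (Fin n), orderOf g = m.lcm := by
  obtain ⟨σ, rfl⟩ := (Equiv.Perm.exists_with_cycleType_iff (Fin n)).2
    ⟨by simpa using hsum, htwo⟩
  refine ⟨⟨σ, ?_⟩, ?_⟩
  · rw [Equiv.Perm.mem_alternatingGroup, Equiv.Perm.sign_of_cycleType, heven.neg_one_pow]
  · rw [Equiv.Perm.lcm_cycleType, Subgroup.orderOf_mk]

/-- If two distinct primes divide the order of a permutation, then their sum is at most the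
number of points. -/
theorem add_le_card_of_dvd_orderOf {α : Type*} [Fintype α] [DecidableEq α]
    {σ : Equiv.Perm α} {p q : ℕ} (hp : p.Prime) (hq : q.Prime) (hpq : p ≠ q)
    (hpσ : p ∣ orderOf σ) (hqσ : q ∣ orderOf σ) : p + q ≤ Fintype.card α := by
  refine le_trans ?_ σ.sum_cycleType_le
  obtain ⟨a, ha, hpa⟩ := exists_mem_cycleType_of_prime_dvd_orderOf hp hpσ
  obtain ⟨b, hb, hqb⟩ := exists_mem_cycleType_of_prime_dvd_orderOf hq hqσ
  have hpos : ∀ c ∈ σ.cycleType, 0 < c := fun c hc =>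
    zero_lt_two.trans_le (Equiv.Perm.two_le_of_mem_cycleType hc)
  have hpa' := Nat.le_of_dvd (hpos a ha) hpa
  have hqb' := Nat.le_of_dvd (hpos b hb) hqb
  obtain ⟨m, hm⟩ := Multiset.exists_cons_of_mem ha
  rw [hm, Multiset.mem_cons] at hb
  rw [hm, Multiset.sum_cons]
  rcases hb with rfl | hb
  · have hmul := Nat.le_of_dvd (hpos b ha)
      (((Nat.coprime_primes hp hq).2 hpq).mul_dvd_of_dvd_of_dvd hpa hqb)
    have := Nat.add_le_mul hp.two_le hq.two_le
    omega
  · have := Multiset.le_sum_of_mem hb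
    omega

/-- If `2` and an odd prime `p` divide the order of an even permutation, then `4 + p` is at most
the number of points. -/
theorem four_add_le_card_of_dvd_orderOf {α : Type*} [Fintype α] [DecidableEq α]
    {σ : Equiv.Perm α} (hσ : Equiv.Perm.sign σ = 1) {p : ℕ} (hp : p.Prime) (hodd : Odd p)
    (htwo : 2 ∣ orderOf σ) (hpσ : p ∣ orderOf σ) : 4 + p ≤ Fintype.card α := by
  refine le_trans ?_ σ.sum_cycleType_le
  obtain ⟨a, ha, h2a⟩ := exists_mem_cycleType_of_prime_dvd_orderOf Nat.prime_two htwo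
  obtain ⟨c, hc, hpc⟩ := exists_mem_cycleType_of_prime_dvd_orderOf hp hpσ
  obtain ⟨m, hm⟩ := Multiset.exists_cons_of_mem ha
  obtain ⟨b, hb, h2b⟩ := exists_even_mem_of_sign_eq_one hσ hm (even_iff_two_dvd.2 h2a)
  obtain ⟨m', rfl⟩ := Multiset.exists_cons_of_mem hb
  have htwo_le : ∀ d ∈ σ.cycleType, 2 ≤ d := fun _ => Equiv.Perm.two_le_of_mem_cycleType
  have ha2 := htwo_le a ha
  have hb2 := htwo_le b (hm ▸ Multiset.mem_cons_of_mem hb)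
  have hpc' := Nat.le_of_dvd (zero_lt_two.trans_le (htwo_le c hc)) hpc
  have hp2 := hp.two_le
  have hlarge : ∀ d, 2 ≤ d → 2 ∣ d → p ∣ d → 2 * p ≤ d := fun d hd h2 hpd =>
    Nat.le_of_dvd (by omega) (hodd.coprime_two_left.mul_dvd_of_dvd_of_dvd h2 hpd)
  rw [hm, Multiset.mem_cons, Multiset.mem_cons] at hc
  rw [hm, Multiset.sum_cons, Multiset.sum_cons]
  rcases hc with rfl | rfl | hc
  · have := hlarge c ha2 h2a hpc
    omega
  · have := hlarge c hb2 h2b.two_dvd hpc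
    omega
  · have := Multiset.le_sum_of_mem hc
    omega

/-- adjacency criterion in the prime graph of the alternating group
of degree `n ≥ 3`. -/
theorem primeGraph_alternatingGroup_adj (n : ℕ) (hn : 3 ≤ n) :
    (∀ p q : ℕ, p.Prime → q.Prime → Odd p → Odd q → p ≠ q →
      p ∣ Nat.card (alternatingGroup (Fin n)) → q ∣ Nat.card (alternatingGroup (Fin n)) →
      ((primeGraph (alternatingGroup (Fin n))).Adj p q ↔ p + q ≤ n)) ∧
    (∀ p : ℕ, p.Prime → Odd p → p ∣ Nat.card (alternatingGroup (Fin n)) →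
      ((primeGraph (alternatingGroup (Fin n))).Adj 2 p ↔ 4 + p ≤ n)) := by
  constructor
  · intro p q hp hq hpodd hqodd hpq _ _
    constructor
    · rintro ⟨-, -, -, g, hg⟩
      rw [← Subgroup.orderOf_coe] at hg
      simpa using add_le_card_of_dvd_orderOf (σ := (g : Equiv.Perm (Fin n))) hp hq hpq
        (hg ▸ dvd_mul_right p q) (hg ▸ dvd_mul_left q p)
    · intro hle
      obtain ⟨g, hg⟩ := exists_alternatingGroup_orderOf_eq_lcm (n := n) (m := {p, q})
        (by simpa using hle) (by simp [hp.two_le, hq.two_le])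
        (by simpa using (hpodd.add_odd hqodd).add even_two)
      refine ⟨hpq, hp, hq, g, hg.trans ?_⟩
      simpa [lcm_eq_nat_lcm] using ((Nat.coprime_primes hp hq).2 hpq).lcm_eq_mul
  · intro p hp hodd _
    constructor
    · rintro ⟨-, -, -, g, hg⟩
      rw [← Subgroup.orderOf_coe] at hg
      simpa using four_add_le_card_of_dvd_orderOf (Equiv.Perm.mem_alternatingGroup.1 g.2) hp hodd
        (hg ▸ dvd_mul_right 2 p) (hg ▸ dvd_mul_left p 2)
    · intro hle
      obtain ⟨g, hg⟩ := exists_alternatingGroup_orderOf_eq_lcm (n := n) (m := {2, 2, p})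
        (by simp; omega) (by simp [hp.two_le])
        (by obtain ⟨k, rfl⟩ := hodd; exact ⟨k + 4, by simp; ring⟩)
      refine ⟨fun h => absurd hodd (by simp [← h]), Nat.prime_two, hp, g, hg.trans ?_⟩
      have h2p : Nat.lcm 2 p = 2 * p := hodd.coprime_two_left.lcm_eq_mul
      have hdvd : Nat.lcm 2 (2 * p) = 2 * p := Nat.lcm_eq_right (dvd_mul_right 2 p)
      simp [lcm_eq_nat_lcm, h2p, hdvd]
end

section
/- Let n ≥ 2 and let G be the symmetric group of degree n. Then the prime graph GK(G) is a split graph; more precisely, the set C of primes dividing |G| that are at most ⌊n/2⌋ is a clique in GK(G), the set I of primes dividing |G| that are greater than ⌊n/2⌋ is an independent set in GK(G), and C and I partition the vertex set of GK(G). -/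
/-- A split partition of the graph `Γ` with vertex set `S`: a partition of `S`
into a clique `C` and an independent set `I`. -/
def SimpleGraph.IsSplitPartition {V : Type*} (Γ : SimpleGraph V) (S C I : Set V) : Prop :=
  C ∪ I = S ∧ Disjoint C I ∧ Γ.IsClique C ∧ I.Pairwise fun u v => ¬ Γ.Adj u v

/-- `Γ` (with vertex set `S`) is a split graph: `S` can be partitioned into a
clique and an independent set. -/
def SimpleGraph.IsSplit {V : Type*} (Γ : SimpleGraph V) (S : Set V) : Prop :=
  ∃ C I : Set V, Γ.IsSplitPartition S C I

/-- A prime divides the least common multiple of a multiset iff it divides one of its members. -/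
theorem Nat.Prime.dvd_multiset_lcm_iff {p : ℕ} (hp : p.Prime) (m : Multiset ℕ) :
    p ∣ m.lcm ↔ ∃ a ∈ m, p ∣ a := by
  induction m using Multiset.induction_on with
  | empty => simp [hp.ne_one]
  | cons a m ih =>
    rw [Multiset.lcm_cons, lcm_eq_nat_lcm, hp.dvd_lcm, ih]
    simp

namespace Equiv.Perm

variable {α : Type*} [Fintype α]

/-- If `r + s` points are available, the product of disjoint cycles of distinct prime lengths
`r` and `s` has order `r * s`. -/
theorem exists_orderOf_eq_mul_of_prime_add_le {r s : ℕ} (hr : r.Prime) (hs : s.Prime)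
    (hrs : r ≠ s) (h : r + s ≤ Fintype.card α) : ∃ g : Perm α, orderOf g = r * s := by
  classical
  obtain ⟨g, hg⟩ := (exists_with_cycleType_iff α (m := {r, s})).2
    ⟨by simpa using h, by simp [hr.two_le, hs.two_le]⟩
  refine ⟨g, ?_⟩
  rw [← lcm_cycleType, hg]
  simpa [lcm_eq_nat_lcm] using ((Nat.coprime_primes hr hs).2 hrs).lcm_eq_mul

/-- If the order of a permutation is divisible by distinct primes `r` and `s`, then it acts
on at least `r + s` points. -/
theorem prime_add_le_card_of_dvd_orderOf {r s : ℕ} (hr : r.Prime) (hs : s.Prime) (hrs : r ≠ s)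
    {g : Perm α} (hrg : r ∣ orderOf g) (hsg : s ∣ orderOf g) : r + s ≤ Fintype.card α := by
  classical
  rw [← lcm_cycleType] at hrg hsg
  obtain ⟨c, hc, hrc⟩ := (hr.dvd_multiset_lcm_iff _).1 hrg
  obtain ⟨d, hd, hsd⟩ := (hs.dvd_multiset_lcm_iff _).1 hsg
  have hsum : g.cycleType.sum ≤ Fintype.card α := by
    rw [sum_cycleType]
    exact Finset.card_le_univ _
  have hcpos : 0 < c := two_pos.trans_le (two_le_of_mem_cycleType hc)
  have hdpos : 0 < d := two_pos.trans_le (two_le_of_mem_cycleType hd)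
  refine le_trans ?_ hsum
  by_cases hcd : c = d
  · subst hcd
    calc r + s ≤ r * s := by nlinarith [hr.two_le, hs.two_le]
      _ ≤ c := Nat.le_of_dvd hcpos
        (((Nat.coprime_primes hr hs).2 hrs).mul_dvd_of_dvd_of_dvd hrc hsd)
      _ ≤ g.cycleType.sum := Multiset.single_le_sum (fun _ _ => Nat.zero_le _) _ hc
  · obtain ⟨m, hm⟩ := Multiset.exists_cons_of_mem hc
    have hdm : d ∈ m := by
      rw [hm, Multiset.mem_cons] at hd
      exact hd.resolve_left (Ne.symm hcd)
    rw [hm, Multiset.sum_cons]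
    exact add_le_add (Nat.le_of_dvd hcpos hrc) ((Nat.le_of_dvd hdpos hsd).trans
      (Multiset.single_le_sum (fun _ _ => Nat.zero_le _) _ hdm))

end Equiv.Perm

/-- the prime graph of the symmetric group of degree `n ≥ 2` is split,
with clique the primes `≤ ⌊n/2⌋` and independent set the primes `> ⌊n/2⌋`. -/
theorem primeGraph_symmetricGroup_split (n : ℕ) (hn : 2 ≤ n) :
    (primeGraph (Equiv.Perm (Fin n))).IsSplit
      {p : ℕ | p.Prime ∧ p ∣ Nat.card (Equiv.Perm (Fin n))} ∧
    (primeGraph (Equiv.Perm (Fin n))).IsSplitPartition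
      {p : ℕ | p.Prime ∧ p ∣ Nat.card (Equiv.Perm (Fin n))}
      {p : ℕ | (p.Prime ∧ p ∣ Nat.card (Equiv.Perm (Fin n))) ∧ p ≤ n / 2}
      {p : ℕ | (p.Prime ∧ p ∣ Nat.card (Equiv.Perm (Fin n))) ∧ n / 2 < p} := by
  refine (fun h => ⟨⟨_, _, h⟩, h⟩) ⟨?_, ?_, ?_, ?_⟩
  · ext p
    simp only [Set.mem_union, Set.mem_ofPred_eq, ← and_or_left, le_or_gt, and_true]
  · rw [Set.disjoint_left]
    rintro p ⟨-, hle⟩ ⟨-, hlt⟩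
    exact hlt.not_ge hle
  · rintro r ⟨⟨hr, -⟩, hrn⟩ s ⟨⟨hs, -⟩, hsn⟩ hrs
    exact ⟨hrs, hr, hs, Equiv.Perm.exists_orderOf_eq_mul_of_prime_add_le hr hs hrs
      (by rw [Fintype.card_fin]; omega)⟩
  · rintro r ⟨⟨hr, -⟩, hrn⟩ s ⟨⟨hs, -⟩, hsn⟩ hrs ⟨-, -, -, g, hg⟩
    have h := Equiv.Perm.prime_add_le_card_of_dvd_orderOf hr hs hrs
      (hg ▸ Nat.dvd_mul_right r s) (hg ▸ Nat.dvd_mul_left s r)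
    rw [Fintype.card_fin] at h
    omega
end

section
/- Let n ≥ 3 and let G be the alternating group of degree n. Then the solvable graph S(G) is a split graph; more precisely, the set C of primes dividing |G| that are at most ⌊n/2⌋ is a clique in S(G), the set I of primes dividing |G| that are greater than ⌊n/2⌋ is an independent set in S(G), and C and I partition the vertex set of S(G). -/
/-- The solvable graph of a finite group `G`, as a graph on `ℕ`: distinct primes
`r`, `s` are adjacent iff `G` has a solvable subgroup of order divisible by `r * s`. -/
def solvableGraph (G : Type*) [Group G] : SimpleGraph ℕ where
  Adj r s := r ≠ s ∧ r.Prime ∧ s.Prime ∧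
    ∃ H : Subgroup G, IsSolvable H ∧ r * s ∣ Nat.card H
  symm := by
    constructor
    rintro r s ⟨hne, hr, hs, H, hH, hdvd⟩
    exact ⟨hne.symm, hs, hr, H, hH, by rwa [Nat.mul_comm] at hdvd⟩
  loopless := by constructor; rintro r ⟨hne, _⟩; exact hne rfl

open Equiv Equiv.Perm

/-- A subgroup of a quotient pulls back to a subgroup of order multiplied by that of the kernel. -/
theorem Subgroup.card_comap_mk' {G : Type*} [Group G] [Finite G] (N : Subgroup G) [N.Normal]
    (K : Subgroup (G ⧸ N)) :
    Nat.card (K.comap (QuotientGroup.mk' N)) = Nat.card N * Nat.card K := by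
  have h₁ := (K.comap (QuotientGroup.mk' N)).card_mul_index
  rw [K.index_comap_of_surjective (QuotientGroup.mk'_surjective N), ← N.card_mul_index,
    Subgroup.index_eq_card N, ← K.card_mul_index, ← mul_assoc] at h₁
  exact Nat.eq_of_mul_eq_mul_right (Nat.pos_of_ne_zero K.index_ne_zero_of_finite) h₁

/-- A nontrivial solvable group has a nontrivial abelian normal subgroup. -/
theorem Group.IsSolvable.exists_normal_isMulCommutative (G : Type*) [Group G] [Group.IsSolvable G]
    [Nontrivial G] : ∃ A : Subgroup G, A.Normal ∧ A ≠ ⊥ ∧ IsMulCommutative A := by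
  classical
  have h : ∃ n, derivedSeries G n = ⊥ := ‹Group.IsSolvable G›.solvable
  obtain ⟨m, hm⟩ : ∃ m, Nat.find h = m + 1 := by
    refine Nat.exists_eq_succ_of_ne_zero fun h₀ => ?_
    have := Nat.find_spec h
    rw [h₀, derivedSeries_zero] at this
    exact top_ne_bot this
  refine ⟨derivedSeries G m, inferInstance, Nat.find_min h (by omega), ?_⟩
  have hs := Nat.find_spec h
  rw [hm, derivedSeries_succ, Subgroup.commutator_eq_bot_iff_le_centralizer] at hs
  exact Subgroup.le_centralizer_iff_isMulCommutative.mp hs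

/-- A normal subgroup of prime order `p` extends to a subgroup of order `p * q`
for every other prime `q` dividing the order of the group. -/
theorem exists_subgroup_card_mul_of_normal {G : Type*} [Group G] [Finite G] {p q : ℕ}
    (hp : p.Prime) (hq : q.Prime) (hpq : p ≠ q) (hqG : q ∣ Nat.card G) (P : Subgroup G)
    [P.Normal] (hP : Nat.card P = p) : ∃ K : Subgroup G, Nat.card K = p * q := by
  have := Fact.mk hq
  have hdvd : q ∣ Nat.card (G ⧸ P) := by
    rw [← P.card_mul_index, hP] at hqG
    exact (((Nat.coprime_primes hq hp).mpr hpq.symm).dvd_mul_left).mp hqG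
  obtain ⟨x, hx⟩ := exists_prime_orderOf_dvd_card' q hdvd
  exact ⟨_, by rw [P.card_comap_mk' (Subgroup.zpowers x), hP, Nat.card_zpowers, hx]⟩

/-- If an abelian normal subgroup has order divisible by `p` exactly once, then the group
has a normal subgroup of order `p`. -/
theorem exists_normal_subgroup_card_prime {G : Type*} [Group G] [Finite G] {p : ℕ}
    (hp : p.Prime) (A : Subgroup G) [A.Normal] [IsMulCommutative A] (hpA : p ∣ Nat.card A)
    (hp2 : ¬ p ^ 2 ∣ Nat.card A) : ∃ P : Subgroup G, P.Normal ∧ Nat.card P = p := by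
  have := Fact.mk hp
  let P : Sylow p A := default
  have hchar : (P : Subgroup A).Characteristic := P.characteristic_of_normal inferInstance
  refine ⟨(P : Subgroup A).map A.subtype, inferInstance, ?_⟩
  rw [Subgroup.card_map_of_injective A.subtype_injective]
  obtain ⟨k, hk⟩ := IsPGroup.iff_card.mp P.isPGroup'
  have h₁ : p ∣ Nat.card P := P.dvd_card_of_dvd_card hpA
  have h₂ : Nat.card P ∣ Nat.card A := Subgroup.card_subgroup_dvd_card _
  rw [hk] at h₁ h₂
  have hk1 : k = 1 := by
    have hk0 : k ≠ 0 := by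
      rintro rfl
      exact hp.one_lt.ne' (Nat.dvd_one.mp (by simpa using h₁))
    have hk2 : k < 2 := by
      by_contra! hk2
      exact hp2 ((pow_dvd_pow p hk2).trans h₂)
    omega
  rw [hk, hk1, pow_one]

/-- The case of Hall's theorem for two primes that divide the order exactly once. -/
theorem Group.IsSolvable.exists_subgroup_card_mul {p q : ℕ} (hp : p.Prime) (hq : q.Prime)
    (hpq : p ≠ q) (G : Type*) [Group G] [Finite G] [Group.IsSolvable G] (hpG : p ∣ Nat.card G)
    (hqG : q ∣ Nat.card G) (hp2 : ¬ p ^ 2 ∣ Nat.card G) (hq2 : ¬ q ^ 2 ∣ Nat.card G) :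
    ∃ K : Subgroup G, Nat.card K = p * q := by
  induction hn : Nat.card G using Nat.strong_induction_on generalizing G with
  | _ n ih =>
  subst hn
  have : Nontrivial G := by
    by_contra! h
    rw [Nat.card_of_subsingleton (1 : G)] at hpG
    exact hp.one_lt.ne' (Nat.dvd_one.mp hpG)
  obtain ⟨A, hA, hAbot, hAcomm⟩ := Group.IsSolvable.exists_normal_isMulCommutative G
  have hAdvd : Nat.card A ∣ Nat.card G := A.card_subgroup_dvd_card
  by_cases hpA : p ∣ Nat.card A
  · obtain ⟨P, hP, hPc⟩ := exists_normal_subgroup_card_prime hp A hpA fun h => hp2 (h.trans hAdvd)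
    exact exists_subgroup_card_mul_of_normal hp hq hpq hqG P hPc
  by_cases hqA : q ∣ Nat.card A
  · obtain ⟨P, hP, hPc⟩ := exists_normal_subgroup_card_prime hq A hqA fun h => hq2 (h.trans hAdvd)
    rw [mul_comm]
    exact exists_subgroup_card_mul_of_normal hq hp hpq.symm hpG P hPc
  have hcard : Nat.card A * Nat.card (G ⧸ A) = Nat.card G := A.card_mul_index
  have hQdvd : Nat.card (G ⧸ A) ∣ Nat.card G := Dvd.intro_left _ hcard
  have hA1 : 1 < Nat.card A := (Subgroup.one_lt_card_iff_ne_bot A).mpr hAbot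
  have hlt : Nat.card (G ⧸ A) < Nat.card G := by
    rw [← hcard]
    exact lt_mul_left Nat.card_pos hA1
  obtain ⟨K, hK⟩ := ih _ hlt (G ⧸ A)
    (((hp.dvd_mul).mp (hcard ▸ hpG)).resolve_left hpA)
    (((hq.dvd_mul).mp (hcard ▸ hqG)).resolve_left hqA)
    (fun h => hp2 (h.trans hQdvd)) (fun h => hq2 (h.trans hQdvd)) rfl
  set L := K.comap (QuotientGroup.mk' A) with hL
  have hLcard : Nat.card L = Nat.card A * (p * q) := by rw [hL, A.card_comap_mk', hK]
  have hAL : A ≤ L := by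
    rw [hL]
    exact QuotientGroup.le_comap_mk' A K
  have hNcard : Nat.card (A.subgroupOf L) = Nat.card A :=
    Nat.card_congr (Subgroup.subgroupOfEquivOfLe hAL).toEquiv
  have hidx : (A.subgroupOf L).index = p * q := by
    have := (A.subgroupOf L).card_mul_index
    rw [hNcard, hLcard] at this
    exact Nat.eq_of_mul_eq_mul_left (by omega) this
  have hcop : Nat.Coprime (Nat.card (A.subgroupOf L)) (A.subgroupOf L).index := by
    rw [hNcard, hidx]
    exact Nat.Coprime.mul_right ((hp.coprime_iff_not_dvd.mpr hpA).symm)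
      ((hq.coprime_iff_not_dvd.mpr hqA).symm)
  obtain ⟨M, hM⟩ := Subgroup.exists_right_complement'_of_coprime hcop
  refine ⟨M.map L.subtype, ?_⟩
  rw [Subgroup.card_map_of_injective L.subtype_injective]
  have := hM.card_mul_card
  rw [hNcard, hLcard] at this
  exact Nat.eq_of_mul_eq_mul_left (by omega) this

/-- If `x` normalizes the group generated by a cycle `c` of prime order and fixes two points moved
by `c`, then `x` and `c` are disjoint. -/
theorem Equiv.Perm.IsCycle.disjoint_of_conj_eq_zpow {α : Type*} [Fintype α] [DecidableEq α]
    {x c : Perm α} (hc : c.IsCycle) (hq : (orderOf c).Prime) {k : ℤ}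
    (hk : x * c * x⁻¹ = c ^ k) {a b : α} (hab : a ≠ b) (ha : c a ≠ a) (hb : c b ≠ b)
    (hxa : x a = a) (hxb : x b = b) : x.Disjoint c := by
  have hconj : ∀ j : ℤ, x ((c ^ j) a) = (c ^ (k * j)) a := fun j => by
    have h : x * c ^ j = c ^ (k * j) * x := by
      rw [zpow_mul, ← hk, conj_zpow, inv_mul_cancel_right]
    simpa [hxa] using congrArg (· a) h
  obtain ⟨i, hi⟩ := hc.sameCycle ha hb
  have hfix : (c ^ ((k - 1) * i)) a = a := by
    have h := hconj i
    rw [hi, hxb, ← hi] at h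
    have h' : c ^ ((k - 1) * i) = (c ^ i)⁻¹ * c ^ (k * i) := by
      rw [← zpow_neg, ← zpow_add]
      ring_nf
    rw [h', Perm.mul_apply, ← h, Perm.inv_eq_iff_eq]
  have hdvd : (orderOf c : ℤ) ∣ (k - 1) * i := by
    rw [orderOf_dvd_iff_zpow_eq_one]
    ext y
    by_cases hy : c y = y
    · rw [Perm.zpow_apply_eq_self_of_apply_eq_self hy, Perm.one_apply]
    · obtain ⟨j, rfl⟩ := hc.sameCycle ha hy
      rw [Perm.zpow_apply_comm, hfix, Perm.one_apply]
  have hk1 : c ^ k = c := by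
    rcases (Nat.prime_iff_prime_int.mp hq).dvd_or_dvd hdvd with h | h
    · have := orderOf_dvd_iff_zpow_eq_one.mp h
      rwa [zpow_sub_one, mul_inv_eq_one] at this
    · rw [orderOf_dvd_iff_zpow_eq_one.mp h] at hi
      exact absurd hi hab
  intro y
  by_cases hy : c y = y
  · exact Or.inr hy
  · obtain ⟨j, rfl⟩ := hc.sameCycle ha hy
    left
    rw [hconj, zpow_mul, hk1]

/-- A permutation group of degree less than `2 * p` has order `p * q`, for primes `p < q`,
only if `q = p + 1`. -/
theorem eq_succ_of_card_subgroup_perm {α : Type*} [Fintype α] {p q : ℕ} (hp : p.Prime)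
    (hq : q.Prime) (hlt : p < q) (hα : Fintype.card α < 2 * p) (K : Subgroup (Perm α))
    (hK : Nat.card K = p * q) : q = p + 1 := by
  classical
  have := Fact.mk hp
  have := Fact.mk hq
  obtain ⟨x, hx⟩ := exists_prime_orderOf_dvd_card' (G := K) p (hK ▸ Dvd.intro _ rfl)
  obtain ⟨c, hc⟩ := exists_prime_orderOf_dvd_card' (G := K) q (hK ▸ Dvd.intro_left _ rfl)
  have hnormal : (Subgroup.zpowers c).Normal := by
    apply Subgroup.normal_of_index_eq_minFac_card
    have h := (Subgroup.zpowers c).card_mul_index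
    rw [Nat.card_zpowers, hc, hK, mul_comm p] at h
    rw [Nat.eq_of_mul_eq_mul_left hq.pos h, hK]
    have hmin : (p * q).minFac.Prime :=
      Nat.minFac_prime fun h => hp.ne_one (Nat.eq_one_of_mul_eq_one_right h)
    rcases hmin.dvd_mul.mp (Nat.minFac_dvd _) with h | h
    · exact ((Nat.prime_dvd_prime_iff_eq hmin hp).mp h).symm
    · have := (Nat.prime_dvd_prime_iff_eq hmin hq).mp h
      have := Nat.minFac_le_of_dvd hp.two_le (Dvd.intro q rfl)
      omega
  obtain ⟨k, hk⟩ := Subgroup.mem_zpowers_iff.mp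
    (hnormal.conj_mem c (Subgroup.mem_zpowers c) x)
  have hk' : (x * c * x⁻¹ : Perm α) = (c : Perm α) ^ k := by
    simpa using congrArg Subtype.val hk.symm
  rw [← Subgroup.orderOf_coe] at hx hc
  have hxc : (x : Perm α).IsCycle := isCycle_of_prime_order' (hx ▸ hp) (by omega)
  have hcc : (c : Perm α).IsCycle := isCycle_of_prime_order' (hc ▸ hq) (by omega)
  have hxs := hxc.orderOf.symm.trans hx
  have hcs := hcc.orderOf.symm.trans hc
  have hle : ((c : Perm α).support \ (x : Perm α).support).card ≤ 1 := by
    refine Finset.card_le_one.mpr fun a ha b hb => by_contra fun hab => ?_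
    simp only [Finset.mem_sdiff, mem_support, not_not] at ha hb
    have hd := hcc.disjoint_of_conj_eq_zpow (hc ▸ hq) hk' hab ha.1 hb.1 ha.2 hb.2
    have h₁ := hd.card_support_mul
    have h₂ := Finset.card_le_univ ((x : Perm α) * c).support
    omega
  have := Finset.card_le_card_sdiff_add_card (s := (c : Perm α).support)
    (t := (x : Perm α).support)
  omega

/-- The square of a prime `p` does not divide `n!` when `n < 2 * p`. -/
theorem Nat.Prime.not_sq_dvd_factorial {p n : ℕ} (hp : p.Prime) (hn : n < 2 * p) :
    ¬ p ^ 2 ∣ n.factorial := by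
  have := Fact.mk hp
  have hdiv : n / p < 2 := Nat.div_lt_of_lt_mul (by omega)
  rw [padicValNat_dvd_iff_le n.factorial_ne_zero, ← padicValNat_mul_div_factorial,
    padicValNat_factorial_mul]
  interval_cases n / p <;> simp

/-- If `r` inverts `c` under conjugation, then `r` and `c` lie in a common solvable subgroup. -/
theorem exists_isSolvable_subgroup_of_conj_eq_inv {G : Type*} [Group G] {r c : G}
    (h : r * c * r⁻¹ = c⁻¹) : ∃ H : Subgroup G, Group.IsSolvable H ∧ r ∈ H ∧ c ∈ H := by
  let N := Subgroup.zpowers c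
  let L := Subgroup.normalizer (N : Set G)
  have hr : r ∈ L := by
    refine Subgroup.mem_normalizer_iff.mpr fun x => ⟨?_, fun hx => ?_⟩
    · rintro ⟨k, rfl⟩
      exact ⟨-k, by simp only [← conj_zpow, h, inv_zpow']⟩
    · obtain ⟨k, hk⟩ := hx
      refine ⟨-k, ?_⟩
      have hk' : x = r⁻¹ * c ^ k * r := by
        rw [show c ^ k = r * x * r⁻¹ from hk]
        group
      have hc : r⁻¹ * c ^ k * r = c ^ (-k) := by
        have : r * c ^ (-k) * r⁻¹ = c ^ k := by
          rw [← conj_zpow, h, inv_zpow', neg_neg]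
        rw [← this]
        group
      exact (hk'.trans hc).symm
  have hc : c ∈ L := Subgroup.le_normalizer (Subgroup.mem_zpowers c)
  let M := N.subgroupOf L
  let K : Subgroup (L ⧸ M) := Subgroup.zpowers (QuotientGroup.mk' M ⟨r, hr⟩)
  let T : Subgroup L := K.comap (QuotientGroup.mk' M)
  have hMT : M ≤ T := QuotientGroup.le_comap_mk' M K
  have hN : Group.IsSolvable N := Group.isSolvable_of_comm fun a b => mul_comm' a b
  have hK : Group.IsSolvable K := Group.isSolvable_of_comm fun a b => mul_comm' a b
  have hM : Group.IsSolvable M :=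
    Group.isSolvable_of_isSolvable_injective
      (f := (Subgroup.subgroupOfEquivOfLe (Subgroup.le_normalizer (H := N))).toMonoidHom)
      (MulEquiv.injective _)
  have hT : Group.IsSolvable T := by
    refine Group.isSolvable_of_ker_le_range (Subgroup.inclusion hMT)
      ((QuotientGroup.mk' M).subgroupComap K) fun x hx => ?_
    have hx' : (x : L) ∈ M := (QuotientGroup.eq_one_iff _).mp (congrArg Subtype.val hx)
    exact ⟨⟨x, hx'⟩, rfl⟩
  refine ⟨T.map L.subtype, Group.isSolvable_of_surjective (L.subtype.subgroupMap_surjective T),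
    ⟨⟨r, hr⟩, Subgroup.mem_zpowers _, rfl⟩, ⟨⟨c, hc⟩, hMT ?_, rfl⟩⟩
  exact Subgroup.mem_zpowers c

/-- An element inverting an element whose square is nontrivial has even order. -/
theorem even_orderOf_of_conj_eq_inv {G : Type*} [Group G] {r c : G} (h : r * c * r⁻¹ = c⁻¹)
    (hc : c ^ 2 ≠ 1) : Even (orderOf r) := by
  by_contra hodd
  obtain ⟨k, hk⟩ := Nat.not_even_iff_odd.mp hodd
  have hr2 : Commute (r ^ 2) c := by
    rw [Commute, SemiconjBy, ← mul_inv_eq_iff_eq_mul]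
    calc r ^ 2 * c * (r ^ 2)⁻¹ = r * (r * c * r⁻¹) * r⁻¹ := by rw [pow_two]; group
      _ = (r * c * r⁻¹)⁻¹ := by rw [h, ← conj_inv, h]
      _ = c := by rw [h, inv_inv]
  have hr : (r ^ 2) ^ (k + 1) = r := by
    rw [← pow_mul, show 2 * (k + 1) = orderOf r + 1 by omega, pow_succ, pow_orderOf_eq_one, one_mul]
  have hrc : r * c * r⁻¹ = c := by
    have := hr2.pow_left (k + 1)
    rw [hr] at this
    rw [this.eq, mul_inv_cancel_right]
  refine hc ?_
  rw [pow_two, ← eq_inv_iff_mul_eq_one, ← h, hrc]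

/-- Two odd primes with sum at most `n` are adjacent in the solvable graph of `Aₙ`. -/
theorem exists_isSolvable_of_odd_primes {n p q : ℕ} (hp : p.Prime) (hq : q.Prime) (hpq : p ≠ q)
    (hp2 : p ≠ 2) (hq2 : q ≠ 2) (hn : p + q ≤ n) :
    ∃ H : Subgroup (alternatingGroup (Fin n)), Group.IsSolvable H ∧ p * q ∣ Nat.card H := by
  obtain ⟨σ, hσ⟩ := (Perm.exists_with_cycleType_iff (Fin n) (m := {p, q})).mpr
    ⟨by simpa using hn, by simp [hp.two_le, hq.two_le]⟩
  have hsign : σ ∈ alternatingGroup (Fin n) := by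
    rw [mem_alternatingGroup, sign_of_cycleType, hσ]
    have := hp.odd_of_ne_two hp2
    have := hq.odd_of_ne_two hq2
    exact Even.neg_one_pow (by simp; grind)
  refine ⟨Subgroup.zpowers ⟨σ, hsign⟩, Group.isSolvable_of_comm fun a b => mul_comm' a b, ?_⟩
  rw [Nat.card_zpowers, ← Subgroup.orderOf_coe, ← lcm_cycleType, hσ]
  have := (Nat.coprime_primes hp hq).mpr hpq
  simp [lcm_eq_nat_lcm, this.lcm_eq_mul]

/-- An odd prime `q` with `2 * q ≤ n` is adjacent to `2` in the solvable graph of `Aₙ`. -/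
theorem exists_isSolvable_two_mul {n q : ℕ} (hq : q.Prime) (hq2 : q ≠ 2) (hn : 2 * q ≤ n) :
    ∃ H : Subgroup (alternatingGroup (Fin n)), Group.IsSolvable H ∧ 2 * q ∣ Nat.card H := by
  obtain ⟨σ, hσ⟩ := (Perm.exists_with_cycleType_iff (Fin n) (m := {q})).mpr
    ⟨by simp; omega, by simp [hq.two_le]⟩
  have hodd := hq.odd_of_ne_two hq2
  have hsign : σ ∈ alternatingGroup (Fin n) := by
    rw [mem_alternatingGroup, sign_of_cycleType, hσ]
    exact Even.neg_one_pow (by simp; grind)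
  have horder : orderOf σ = q := by simp [← lcm_cycleType, hσ]
  have hsupp : σ.support.card = q := by simp [← sum_cycleType, hσ]
  let c : alternatingGroup (Fin n) := ⟨σ, hsign⟩
  have hcorder : orderOf c = q := by rw [← Subgroup.orderOf_coe, horder]
  have hconj : IsConj c c⁻¹ := by
    refine alternatingGroup.isConj_of (isConj_of_cycleType_eq (cycleType_inv σ).symm) ?_
    have := hq.two_le
    rw [hsupp, Fintype.card_fin]
    omega
  obtain ⟨r, hr⟩ := isConj_iff.mp hconj
  have hcsq : c ^ 2 ≠ 1 := fun h => by
    have := orderOf_dvd_of_pow_eq_one h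
    rw [hcorder, Nat.prime_dvd_prime_iff_eq hq Nat.prime_two] at this
    exact hq2 this
  obtain ⟨H, hH, hrH, hcH⟩ := exists_isSolvable_subgroup_of_conj_eq_inv hr
  refine ⟨H, hH, Nat.Coprime.mul_dvd_of_dvd_of_dvd
    ((Nat.coprime_primes Nat.prime_two hq).mpr hq2.symm) ?_ ?_⟩
  · exact (even_orderOf_of_conj_eq_inv hr hcsq).two_dvd.trans (H.orderOf_dvd_natCard hrH)
  · exact hcorder ▸ H.orderOf_dvd_natCard hcH

/-- For primes `p < q` with `n < 2 * p`, no solvable subgroup of `Aₙ` has order divisible by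
`p * q`. -/
theorem not_dvd_card_of_isSolvable {n p q : ℕ} (hn : 3 ≤ n) (hp : p.Prime) (hq : q.Prime)
    (hlt : p < q) (hnp : n < 2 * p) (H : Subgroup (alternatingGroup (Fin n)))
    (hH : Group.IsSolvable H) : ¬ p * q ∣ Nat.card H := by
  intro hdvd
  have : Nontrivial (Fin n) := Fin.nontrivial_iff_two_le.mpr (by omega)
  have hcard : Nat.card H ∣ Nat.card (alternatingGroup (Fin n)) := H.card_subgroup_dvd_card
  have hfact : Nat.card H ∣ n.factorial := by
    refine hcard.trans ((Subgroup.card_subgroup_dvd_card _).trans ?_)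
    rw [Nat.card_perm, Nat.card_fin]
  obtain ⟨K, hK⟩ := hH.exists_subgroup_card_mul hp hq hlt.ne H
    ((Dvd.intro _ rfl).trans hdvd) ((Dvd.intro_left _ rfl).trans hdvd)
    (fun h => hp.not_sq_dvd_factorial hnp (h.trans hfact))
    (fun h => hq.not_sq_dvd_factorial (by omega) (h.trans hfact))
  have hsucc := eq_succ_of_card_subgroup_perm hp hq hlt (by simpa using hnp)
    ((K.map H.subtype).map (alternatingGroup (Fin n)).subtype) (by
      rw [Subgroup.card_map_of_injective (Subgroup.subtype_injective _),
        Subgroup.card_map_of_injective (Subgroup.subtype_injective _), hK])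
  have hp2 : p = 2 := by
    by_contra hp2
    have := hp.odd_of_ne_two hp2
    have := hq.odd_of_ne_two (by have := hp.two_le; omega)
    grind
  obtain rfl : n = 3 := by omega
  have h2 : 2 ∣ Nat.card (alternatingGroup (Fin 3)) := by
    subst hp2
    exact ((Dvd.intro _ rfl).trans hdvd).trans hcard
  rw [nat_card_alternatingGroup] at h2
  simp [Nat.factorial] at h2

/-- the solvable graph of the alternating group of degree `n ≥ 3` is split,
with clique the primes `≤ ⌊n/2⌋` and independent set the primes `> ⌊n/2⌋`. -/
theorem solvableGraph_alternatingGroup_split (n : ℕ) (hn : 3 ≤ n) :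
    (solvableGraph (alternatingGroup (Fin n))).IsSplit
      {p : ℕ | p.Prime ∧ p ∣ Nat.card (alternatingGroup (Fin n))} ∧
    (solvableGraph (alternatingGroup (Fin n))).IsSplitPartition
      {p : ℕ | p.Prime ∧ p ∣ Nat.card (alternatingGroup (Fin n))}
      {p : ℕ | (p.Prime ∧ p ∣ Nat.card (alternatingGroup (Fin n))) ∧ p ≤ n / 2}
      {p : ℕ | (p.Prime ∧ p ∣ Nat.card (alternatingGroup (Fin n))) ∧ n / 2 < p} := by
  have key : (solvableGraph (alternatingGroup (Fin n))).IsSplitPartition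
      {p : ℕ | p.Prime ∧ p ∣ Nat.card (alternatingGroup (Fin n))}
      {p : ℕ | (p.Prime ∧ p ∣ Nat.card (alternatingGroup (Fin n))) ∧ p ≤ n / 2}
      {p : ℕ | (p.Prime ∧ p ∣ Nat.card (alternatingGroup (Fin n))) ∧ n / 2 < p} := by
    refine ⟨?_, ?_, ?_, ?_⟩
    · ext p
      simp only [Set.mem_union, Set.mem_ofPred_eq]
      have := le_or_gt p (n / 2)
      tauto
    · rw [Set.disjoint_left]
      rintro p ⟨_, hle⟩ ⟨_, hgt⟩
      omega
    · rintro p ⟨⟨hp, _⟩, hpn⟩ q ⟨⟨hq, _⟩, hqn⟩ hpq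
      refine ⟨hpq, hp, hq, ?_⟩
      by_cases hp2 : p = 2
      · subst hp2
        exact exists_isSolvable_two_mul hq hpq.symm (by omega)
      by_cases hq2 : q = 2
      · subst hq2
        rw [mul_comm]
        exact exists_isSolvable_two_mul hp hpq (by omega)
      exact exists_isSolvable_of_odd_primes hp hq hpq hp2 hq2 (by omega)
    · rintro p ⟨_, hpn⟩ q ⟨_, hqn⟩ - ⟨hpq, hp, hq, H, hH, hdvd⟩
      rcases hpq.lt_or_gt with hlt | hlt
      · exact not_dvd_card_of_isSolvable hn hp hq hlt (by omega) H hH hdvd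
      · exact not_dvd_card_of_isSolvable hn hq hp hlt (by omega) H hH (mul_comm p q ▸ hdvd)
  exact ⟨⟨_, _, key⟩, key⟩
end

section
/- Let Γ be a finite simple graph whose compact form Γ_c is a split graph with split partition C ⊎ I (C a clique, I an independent set of Γ_c). If every equivalence class of vertices of Γ that belongs to I is a singleton, then Γ itself is a split graph. -/
/-- The closed neighborhood of a vertex. -/
def closedNbhd {V : Type*} (Γ : SimpleGraph V) (v : V) : Set V := insert v (Γ.neighborSet v)

/-- Vertices are equivalent iff they have the same closed neighborhood. -/
def nbhdSetoid {V : Type*} (Γ : SimpleGraph V) : Setoid V where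
  r u v := closedNbhd Γ u = closedNbhd Γ v
  iseqv := ⟨fun _ => rfl, Eq.symm, Eq.trans⟩

/-- The compact form of `Γ`: the quotient of `Γ` by equality of closed
neighborhoods; two distinct classes are adjacent iff some representatives are. -/
def compactForm {V : Type*} (Γ : SimpleGraph V) :
    SimpleGraph (Quotient (nbhdSetoid Γ)) where
  Adj a b := a ≠ b ∧ ∃ u v : V,
    Quotient.mk (nbhdSetoid Γ) u = a ∧ Quotient.mk (nbhdSetoid Γ) v = b ∧ Γ.Adj u v
  symm := by
    constructor
    rintro a b ⟨hne, u, v, hu, hv, huv⟩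
    exact ⟨hne.symm, v, u, hv, hu, huv.symm⟩
  loopless := by constructor; rintro a ⟨hne, _⟩; exact hne rfl

theorem mem_closedNbhd {V : Type*} {Γ : SimpleGraph V} {u v : V} :
    u ∈ closedNbhd Γ v ↔ u = v ∨ Γ.Adj v u :=
  Iff.rfl

theorem mem_closedNbhd_comm {V : Type*} {Γ : SimpleGraph V} {u v : V} :
    u ∈ closedNbhd Γ v ↔ v ∈ closedNbhd Γ u := by
  rw [mem_closedNbhd, mem_closedNbhd, eq_comm, Γ.adj_comm]

theorem mem_closedNbhd_congr {V : Type*} {Γ : SimpleGraph V} {u u' v v' : V}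
    (hu : closedNbhd Γ u = closedNbhd Γ u') (hv : closedNbhd Γ v = closedNbhd Γ v') :
    u ∈ closedNbhd Γ v ↔ u' ∈ closedNbhd Γ v' := by
  rw [mem_closedNbhd_comm, hu, mem_closedNbhd_comm, hv]

/-- The preimage in `Γ` of a clique of the compact form is a clique. -/
theorem isClique_preimage_of_compactForm {V : Type*} {Γ : SimpleGraph V}
    {C : Set (Quotient (nbhdSetoid Γ))} (hC : (compactForm Γ).IsClique C) :
    Γ.IsClique (Quotient.mk (nbhdSetoid Γ) ⁻¹' C) := by
  intro u hu v hv huv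
  suffices hmem : v ∈ closedNbhd Γ u from
    (mem_closedNbhd.mp hmem).resolve_left huv.symm
  by_cases heq : Quotient.mk (nbhdSetoid Γ) u = Quotient.mk (nbhdSetoid Γ) v
  · have hN : closedNbhd Γ u = closedNbhd Γ v := Quotient.exact heq
    rw [hN]
    exact mem_closedNbhd.mpr (Or.inl rfl)
  · obtain ⟨-, u', v', hu', hv', hadj⟩ := hC hu hv heq
    exact (mem_closedNbhd_congr (Quotient.exact hv') (Quotient.exact hu')).mp
      (mem_closedNbhd.mpr (Or.inr hadj))

/-- if the compact form of a finite graph `Γ` is split with split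
partition `C ⊎ I` and every equivalence class lying in `I` is a singleton, then
`Γ` itself is split. -/
theorem isSplit_of_compactForm_isSplit {V : Type*} [Fintype V] (Γ : SimpleGraph V)
    (C I : Set (Quotient (nbhdSetoid Γ)))
    (h : (compactForm Γ).IsSplitPartition Set.univ C I)
    (hsing : ∀ a ∈ I, ∀ u v : V,
      Quotient.mk (nbhdSetoid Γ) u = a → Quotient.mk (nbhdSetoid Γ) v = a → u = v) :
    Γ.IsSplit Set.univ := by
  obtain ⟨hunion, hdisj, hC, hI⟩ := h
  refine ⟨Quotient.mk (nbhdSetoid Γ) ⁻¹' C, Quotient.mk (nbhdSetoid Γ) ⁻¹' I, ?_,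
    hdisj.preimage _, isClique_preimage_of_compactForm hC, ?_⟩
  · rw [← Set.preimage_union, hunion, Set.preimage_univ]
  · intro u hu v hv huv hadj
    have hne : Quotient.mk (nbhdSetoid Γ) u ≠ Quotient.mk (nbhdSetoid Γ) v :=
      fun heq => huv (hsing _ hv u v heq rfl)
    exact hI hu hv hne ⟨hne, u, v, rfl, rfl, hadj⟩
end

section
/- A finite simple graph is a split graph if and only if it contains no induced subgraph isomorphic to 2K₂ (the disjoint union of two edges), C₄ (the cycle on four vertices), or C₅ (the cycle on five vertices). -/
/-- The graph `2K₂`: two disjoint edges, on four vertices. -/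
def twoKTwo : SimpleGraph (Fin 4) where
  Adj i j := (i = 0 ∧ j = 1) ∨ (i = 1 ∧ j = 0) ∨ (i = 2 ∧ j = 3) ∨ (i = 3 ∧ j = 2)
  symm := by constructor; intro i j h; fin_cases i <;> fin_cases j <;> simp_all
  loopless := by constructor; intro i h; fin_cases i <;> simp_all

/-- The cycle `C₄` on four vertices. -/
def cycleFour : SimpleGraph (Fin 4) where
  Adj i j := j = i + 1 ∨ i = j + 1
  symm := by constructor; intro i j h; fin_cases i <;> fin_cases j <;> simp_all
  loopless := by constructor; intro i h; fin_cases i <;> simp_all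

/-- The cycle `C₅` on five vertices. -/
def cycleFive : SimpleGraph (Fin 5) where
  Adj i j := j = i + 1 ∨ i = j + 1
  symm := by constructor; intro i j h; fin_cases i <;> fin_cases j <;> simp_all
  loopless := by constructor; intro i h; fin_cases i <;> simp_all

namespace SimpleGraph

variable {V : Type*} {Γ : SimpleGraph V}

lemma nonempty_twoKTwo_embedding {a b c d : V} (hab : Γ.Adj a b) (hcd : Γ.Adj c d)
    (hac : ¬ Γ.Adj a c) (had : ¬ Γ.Adj a d) (hbc : ¬ Γ.Adj b c) (hbd : ¬ Γ.Adj b d) :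
    Nonempty (twoKTwo ↪g Γ) := by
  have adj : ∀ i j, Γ.Adj (![a, b, c, d] i) (![a, b, c, d] j) ↔ twoKTwo.Adj i j := by
    intro i j
    fin_cases i <;> fin_cases j <;> simp [twoKTwo, Γ.adj_comm, *]
  refine ⟨⟨⟨![a, b, c, d], fun i j hij => ?_⟩, adj _ _⟩⟩
  have key : ∀ k, twoKTwo.Adj i k ↔ twoKTwo.Adj j k := fun k => by rw [← adj, ← adj, hij]
  revert key
  clear hij
  revert i j
  simp only [twoKTwo]
  decide

lemma nonempty_cycleFour_embedding {a b c d : V} (hab : Γ.Adj a b) (hbc : Γ.Adj b c)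
    (hcd : Γ.Adj c d) (hda : Γ.Adj d a) (hac : ¬ Γ.Adj a c) (hbd : ¬ Γ.Adj b d)
    (hac' : a ≠ c) (hbd' : b ≠ d) : Nonempty (cycleFour ↪g Γ) := by
  have adj : ∀ i j, Γ.Adj (![a, b, c, d] i) (![a, b, c, d] j) ↔ cycleFour.Adj i j := by
    intro i j
    fin_cases i <;> fin_cases j <;> simp [cycleFour, *] <;> simp_all [Γ.adj_comm]
  refine ⟨⟨⟨![a, b, c, d], fun i j hij => ?_⟩, adj _ _⟩⟩
  have := hab.ne
  have := hbc.ne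
  have := hcd.ne
  have := hda.ne
  fin_cases i <;> fin_cases j <;> simp_all

lemma nonempty_cycleFive_embedding {a b c d e : V} (hab : Γ.Adj a b) (hbc : Γ.Adj b c)
    (hcd : Γ.Adj c d) (hde : Γ.Adj d e) (hea : Γ.Adj e a) (hac : ¬ Γ.Adj a c)
    (had : ¬ Γ.Adj a d) (hbd : ¬ Γ.Adj b d) (hbe : ¬ Γ.Adj b e) (hce : ¬ Γ.Adj c e) :
    Nonempty (cycleFive ↪g Γ) := by
  have adj : ∀ i j, Γ.Adj (![a, b, c, d, e] i) (![a, b, c, d, e] j) ↔ cycleFive.Adj i j := by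
    intro i j
    fin_cases i <;> fin_cases j <;> simp [cycleFive, *] <;> simp_all [Γ.adj_comm]
  refine ⟨⟨⟨![a, b, c, d, e], fun i j hij => ?_⟩, adj _ _⟩⟩
  have key : ∀ k, cycleFive.Adj i k ↔ cycleFive.Adj j k := fun k => by rw [← adj, ← adj, hij]
  revert key
  clear hij
  revert i j
  simp only [cycleFive]
  decide

/-- An induced subgraph of a split graph admits a two-colouring whose `true` class is a clique and
whose `false` class is independent. -/
lemma IsSplit.exists_coloring {W : Type*} {H : SimpleGraph W} (h : Γ.IsSplit Set.univ)
    (f : H ↪g Γ) : ∃ c : W → Bool, ∀ i j, i ≠ j → c i = c j → (H.Adj i j ↔ c i = true) := by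
  classical
  obtain ⟨C, I, hCI, -, hC, hI⟩ := h
  have mem_I : ∀ v, v ∉ C → v ∈ I := fun v hv =>
    (hCI.symm ▸ Set.mem_univ v : v ∈ C ∪ I).resolve_left hv
  refine ⟨fun i => decide (f i ∈ C), fun i j hij hc => ?_⟩
  have hne : f i ≠ f j := f.injective.ne hij
  rw [← f.map_adj_iff]
  by_cases hi : f i ∈ C
  · have hj : f j ∈ C := by simpa [hi] using hc
    simpa [hi] using hC hi hj hne
  · have hj : f j ∉ C := by simpa [hi] using hc
    simpa [hi] using hI (mem_I _ hi) (mem_I _ hj) hne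

/-- There is a clique of maximal weight: no clique has a larger sum of `degree + card V`. -/
lemma exists_isClique_max_weight [Fintype V] [DecidableRel Γ.Adj] :
    ∃ K : Finset V, Γ.IsClique (K : Set V) ∧ ∀ L : Finset V, Γ.IsClique (L : Set V) →
      ∑ v ∈ L, (Γ.degree v + Fintype.card V) ≤ ∑ v ∈ K, (Γ.degree v + Fintype.card V) := by
  classical
  obtain ⟨K, hK, hmax⟩ := Finset.exists_max_image
    (Finset.univ.filter fun K : Finset V => Γ.IsClique (K : Set V))
    (fun K => ∑ v ∈ K, (Γ.degree v + Fintype.card V)) ⟨∅, by simp⟩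
  exact ⟨K, by simpa using hK, fun L hL => hmax L (by simpa using hL)⟩

/-- Outside a clique of maximal weight, an edge `xy` such that every vertex of the clique missed by
`x` is also missed by `y` produces a forbidden induced subgraph. -/
lemma exists_forbidden_of_nested [Fintype V] [DecidableRel Γ.Adj] {K : Finset V}
    (hK : Γ.IsClique (K : Set V))
    (hmax : ∀ L : Finset V, Γ.IsClique (L : Set V) →
      ∑ v ∈ L, (Γ.degree v + Fintype.card V) ≤ ∑ v ∈ K, (Γ.degree v + Fintype.card V))
    {x y : V} (hx : x ∉ K) (hy : y ∉ K) (hxy : Γ.Adj x y)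
    (hnest : ∀ v ∈ K, ¬ Γ.Adj x v → ¬ Γ.Adj y v) :
    Nonempty (twoKTwo ↪g Γ) ∨ Nonempty (cycleFour ↪g Γ) ∨ Nonempty (cycleFive ↪g Γ) := by
  classical
  have card_pos : 0 < Fintype.card V := Fintype.card_pos_iff.2 ⟨x⟩
  obtain ⟨z, hz, hxz⟩ : ∃ z ∈ K, ¬ Γ.Adj x z := by
    by_contra! h
    have := hmax (insert x K) (by
      rw [Finset.coe_insert]
      exact hK.insert fun v hv _ => h v hv)
    rw [Finset.sum_insert hx] at this
    omega
  have hyz := hnest z hz hxz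
  by_cases huniq : ∃ u ∈ K, u ≠ z ∧ ¬ Γ.Adj x u
  · obtain ⟨u, hu, huz, hxu⟩ := huniq
    exact .inl (nonempty_twoKTwo_embedding hxy (hK hu hz huz) hxu hxz (hnest u hu hxu) hyz)
  push Not at huniq
  have hswap : Γ.IsClique (insert x (K.erase z) : Finset V) := by
    rw [Finset.coe_insert]
    refine (hK.subset (by simp)).insert fun v hv _ => ?_
    simp only [Finset.coe_erase, Set.mem_sdiff, Finset.mem_coe, Set.mem_singleton_iff] at hv
    exact huniq v hv.1 hv.2
  have hsum := Finset.add_sum_erase K (fun v => Γ.degree v + Fintype.card V) hz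
  have hx' : x ∉ K.erase z := fun h => hx (Finset.mem_of_mem_erase h)
  obtain ⟨w, hw, hwz, hyw⟩ : ∃ w ∈ K, w ≠ z ∧ ¬ Γ.Adj y w := by
    by_contra! h
    have hy' : y ∉ insert x (K.erase z) := by simp [hxy.ne', hy]
    have := hmax (insert y (insert x (K.erase z))) (by
      rw [Finset.coe_insert]
      refine hswap.insert fun v hv _ => ?_
      simp only [Finset.coe_insert, Finset.coe_erase, Set.mem_insert_iff, Set.mem_sdiff,
        Finset.mem_coe, Set.mem_singleton_iff] at hv
      obtain rfl | hv := hv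
      · exact hxy.symm
      · exact h v hv.1 hv.2)
    rw [Finset.sum_insert hy', Finset.sum_insert hx'] at this
    have := Γ.degree_lt_card_verts z
    omega
  have hdeg : Γ.degree x ≤ Γ.degree z := by
    have := hmax _ hswap
    rw [Finset.sum_insert hx'] at this
    omega
  obtain ⟨t, hzt, hxt⟩ : ∃ t, Γ.Adj z t ∧ ¬ Γ.Adj x t := by
    by_contra! h
    have : Γ.neighborFinset z ⊂ Γ.neighborFinset x := by
      refine Finset.ssubset_iff_of_subset (fun t ht => ?_) |>.2 ⟨y, ?_, ?_⟩
      · simpa using h t (by simpa using ht)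
      · simpa using hxy
      · simpa using fun h => hyz h.symm
    exact hdeg.not_gt (Finset.card_lt_card this)
  have hxw : Γ.Adj x w := huniq w hw hwz
  have hzw : Γ.Adj z w := hK hz hw hwz.symm
  by_cases hyt : Γ.Adj y t
  · by_cases htw : Γ.Adj t w
    · refine .inr (.inl (nonempty_cycleFour_embedding hxy hyt htw hxw.symm hxt hyw ?_ ?_))
      · rintro rfl
        exact hxz hzt.symm
      · rintro rfl
        exact hy hw
    · exact .inr (.inr (nonempty_cycleFive_embedding hxy hyt hzt.symm hzw hxw.symm
        hxt hxz hyz hyw htw))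
  · exact .inl (nonempty_twoKTwo_embedding hxy hzt hxz hxt hyz hyt)

lemma exists_forbidden_of_not_isSplit [Fintype V] (h : ¬ Γ.IsSplit Set.univ) :
    Nonempty (twoKTwo ↪g Γ) ∨ Nonempty (cycleFour ↪g Γ) ∨ Nonempty (cycleFive ↪g Γ) := by
  classical
  obtain ⟨K, hK, hmax⟩ := Γ.exists_isClique_max_weight
  obtain ⟨x, hx, y, hy, hxy⟩ : ∃ x ∉ K, ∃ y ∉ K, Γ.Adj x y := by
    by_contra! hind
    exact h ⟨K, (K : Set V)ᶜ, by simp, disjoint_compl_right, hK,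
      fun u hu v hv _ => hind u hu v hv⟩
  by_cases hnx : ∀ v ∈ K, ¬ Γ.Adj x v → ¬ Γ.Adj y v
  · exact exists_forbidden_of_nested hK hmax hx hy hxy hnx
  by_cases hny : ∀ v ∈ K, ¬ Γ.Adj y v → ¬ Γ.Adj x v
  · exact exists_forbidden_of_nested hK hmax hy hx hxy.symm hny
  push Not at hnx hny
  obtain ⟨u, hu, hxu, hyu⟩ := hnx
  obtain ⟨v, hv, hyv, hxv⟩ := hny
  have huv : u ≠ v := by
    rintro rfl
    exact hxu hxv
  refine .inr (.inl (nonempty_cycleFour_embedding hxy hyu (hK hu hv huv) hxv.symm hxu hyv ?_ ?_))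
  · rintro rfl
    exact hx hu
  · rintro rfl
    exact hy hv

end SimpleGraph

/-- Földes–Hammer: a finite graph is split iff it has no induced
subgraph isomorphic to `2K₂`, `C₄` or `C₅` (i.e. none of these embeds in it). -/
theorem isSplit_iff_forbidden {V : Type*} [Fintype V] (Γ : SimpleGraph V) :
    Γ.IsSplit Set.univ ↔
      IsEmpty (twoKTwo ↪g Γ) ∧ IsEmpty (cycleFour ↪g Γ) ∧ IsEmpty (cycleFive ↪g Γ) := by
  refine ⟨fun h => ⟨⟨fun f => ?_⟩, ⟨fun f => ?_⟩, ⟨fun f => ?_⟩⟩, fun ⟨h₁, h₂, h₃⟩ => ?_⟩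
  · obtain ⟨c, hc⟩ := h.exists_coloring f
    revert c
    simp only [twoKTwo]
    decide
  · obtain ⟨c, hc⟩ := h.exists_coloring f
    revert c
    simp only [cycleFour]
    decide
  · obtain ⟨c, hc⟩ := h.exists_coloring f
    revert c
    simp only [cycleFive]
    decide
  · by_contra h
    obtain h | h | h := SimpleGraph.exists_forbidden_of_not_isSplit h
    · exact not_isEmpty_iff.2 h h₁
    · exact not_isEmpty_iff.2 h h₂
    · exact not_isEmpty_iff.2 h h₃
end

section
/- Let G be a finite group and let N be a solvable normal subgroup of G. Then every prime p dividing |N| is adjacent in the solvable graph S(G) to every other prime dividing |G|; that is, for every prime q ≠ p dividing |G|, the group G has a solvable subgroup whose order is divisible by p·q. -/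
/-- The join of a solvable subgroup and a solvable normal subgroup is solvable. -/
theorem Subgroup.isSolvable_sup_of_normal {G : Type*} [Group G] (K N : Subgroup G) [N.Normal]
    [Group.IsSolvable K] [Group.IsSolvable N] : Group.IsSolvable ↥(K ⊔ N) := by
  refine Group.isSolvable_of_ker_le_range (Subgroup.inclusion (le_sup_right : N ≤ K ⊔ N))
    ((QuotientGroup.quotientInfEquivProdNormalQuotient K N).symm.toMonoidHom.comp
      (QuotientGroup.mk' (N.subgroupOf (K ⊔ N)))) ?_
  intro x hx
  have hxN : (x : G) ∈ N := by
    have hx' : QuotientGroup.mk' (N.subgroupOf (K ⊔ N)) x = 1 := by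
      simpa [MonoidHom.mem_ker] using hx
    simpa [Subgroup.mem_subgroupOf] using hx'
  exact ⟨⟨x, hxN⟩, rfl⟩

/-- primes dividing the order of a solvable normal subgroup are
adjacent in the solvable graph to every other prime dividing the group order. -/
theorem solvableGraph_adj_of_solvable_normal (G : Type*) [Group G] [Finite G]
    (N : Subgroup G) [N.Normal] (hsolv : IsSolvable N)
    (p : ℕ) (hp : p.Prime) (hpN : p ∣ Nat.card N)
    (q : ℕ) (hq : q.Prime) (hqp : q ≠ p) (hqG : q ∣ Nat.card G) :
    (solvableGraph G).Adj p q ∧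
      ∃ H : Subgroup G, IsSolvable H ∧ p * q ∣ Nat.card H := by
  have : Fact q.Prime := ⟨hq⟩
  obtain ⟨x, hx⟩ := exists_prime_orderOf_dvd_card' q hqG
  have : Group.IsSolvable N := hsolv
  have hsup : Group.IsSolvable ↥(Subgroup.zpowers x ⊔ N) :=
    have : Group.IsSolvable (Subgroup.zpowers x) :=
      Group.isSolvable_of_comm (IsMulCommutative.is_comm (M := Subgroup.zpowers x)).comm
    Subgroup.isSolvable_sup_of_normal (Subgroup.zpowers x) N
  have hpH : p ∣ Nat.card ↥(Subgroup.zpowers x ⊔ N) :=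
    hpN.trans (Subgroup.card_dvd_of_le le_sup_right)
  have hqH : q ∣ Nat.card ↥(Subgroup.zpowers x ⊔ N) := by
    rw [← hx, ← Nat.card_zpowers]
    exact Subgroup.card_dvd_of_le le_sup_left
  have hdvd : p * q ∣ Nat.card ↥(Subgroup.zpowers x ⊔ N) :=
    ((Nat.coprime_primes hp hq).2 hqp.symm).mul_dvd_of_dvd_of_dvd hpH hqH
  exact ⟨⟨hqp.symm, hp, hq, _, hsup, hdvd⟩, _, hsup, hdvd⟩
end

section
/- Let G be a finite group and N a normal subgroup of G. If p is a prime dividing |N| and q is a prime dividing |G| but not dividing |N|, then p and q are adjacent in the solvable graph S(G); that is, G has a solvable subgroup whose order is divisible by p·q. -/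
/-- A solvable subgroup and an element normalizing it lie in a common solvable subgroup. -/
theorem exists_isSolvable_of_mem_normalizer {G : Type*} [Group G] (P : Subgroup G)
    [Group.IsSolvable P] {x : G} (hx : x ∈ Subgroup.normalizer (P : Set G)) :
    ∃ H : Subgroup G, Group.IsSolvable H ∧ P ≤ H ∧ x ∈ H := by
  let K := Subgroup.normalizer (P : Set G)
  let Q : Subgroup K := P.subgroupOf K
  have : Q.Normal := Subgroup.normal_in_normalizer
  have hPK : P ≤ K := Subgroup.le_normalizer
  let C : Subgroup (K ⧸ Q) := Subgroup.zpowers (QuotientGroup.mk' Q ⟨x, hx⟩)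
  let L : Subgroup K := C.comap (QuotientGroup.mk' Q)
  have hQL : Q ≤ L := by
    intro y hy
    rw [Subgroup.mem_comap, show QuotientGroup.mk' Q y = 1 from
      (QuotientGroup.eq_one_iff y).2 hy]
    exact C.one_mem
  have hC : Group.IsSolvable C :=
    Group.isSolvable_of_comm (IsCyclic.commGroup (α := C)).mul_comm
  have hL : Group.IsSolvable L := by
    refine Group.isSolvable_of_ker_le_range
      ((Subgroup.inclusion hQL).comp (Subgroup.subgroupOfEquivOfLe hPK).symm.toMonoidHom)
      ((QuotientGroup.mk' Q).subgroupComap C) ?_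
    intro y hy
    have hyQ : (y : K) ∈ Q := (QuotientGroup.eq_one_iff (y : K)).1 (congrArg Subtype.val hy)
    exact ⟨⟨(y : K), hyQ⟩, rfl⟩
  refine ⟨L.map K.subtype,
    Group.isSolvable_of_surjective (K.subtype.subgroupMap_surjective L),
    fun y hy => ⟨⟨y, hPK hy⟩, hQL hy, rfl⟩, ⟨⟨x, hx⟩, Subgroup.mem_zpowers _, rfl⟩⟩

/-- if `p` divides the order of a normal subgroup `N` and `q`
divides the order of `G` but not that of `N`, then `p` and `q` are adjacent in
the solvable graph of `G`. -/
theorem solvableGraph_adj_of_normal (G : Type*) [Group G] [Finite G]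
    (N : Subgroup G) [N.Normal]
    (p : ℕ) (hp : p.Prime) (hpN : p ∣ Nat.card N)
    (q : ℕ) (hq : q.Prime) (hqG : q ∣ Nat.card G) (hqN : ¬ q ∣ Nat.card N) :
    (solvableGraph G).Adj p q ∧
      ∃ H : Subgroup G, IsSolvable H ∧ p * q ∣ Nat.card H := by
  have : Fact p.Prime := ⟨hp⟩
  have : Fact q.Prime := ⟨hq⟩
  have hne : p ≠ q := by
    rintro rfl
    exact hqN hpN
  suffices h : ∃ H : Subgroup G, IsSolvable H ∧ p * q ∣ Nat.card H from ⟨⟨hne, hp, hq, h⟩, h⟩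
  obtain ⟨P⟩ : Nonempty (Sylow p N) := inferInstance
  let M : Subgroup G := (P : Subgroup N).map N.subtype
  have hfrattini : Subgroup.normalizer (M : Set G) ⊔ N = ⊤ := P.normalizer_sup_eq_top
  have hqK : q ∣ Nat.card (Subgroup.normalizer (M : Set G)) := by
    have hindex : q ∣ N.index :=
      (hq.dvd_mul.1 (N.card_mul_index.symm ▸ hqG)).resolve_left hqN
    rw [← Subgroup.relIndex_top_right, ← hfrattini, Subgroup.relIndex_sup_right] at hindex
    exact hindex.trans (N.relIndex_dvd_card _)
  obtain ⟨x, hx⟩ := exists_prime_orderOf_dvd_card' q hqK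
  have hMp : IsPGroup p M := P.isPGroup'.map _
  have : Group.IsNilpotent M := hMp.isNilpotent
  obtain ⟨H, hH, hMH, hxH⟩ := exists_isSolvable_of_mem_normalizer M x.2
  refine ⟨H, hH, ((Nat.coprime_primes hp hq).2 hne).mul_dvd_of_dvd_of_dvd ?_ ?_⟩
  · refine dvd_trans ?_ (Subgroup.card_dvd_of_le hMH)
    rw [Subgroup.card_map_of_injective N.subtype_injective]
    exact P.dvd_card_of_dvd_card hpN
  · rw [← hx, ← Subgroup.orderOf_coe]
    exact H.orderOf_dvd_natCard hxH
end

section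
/- Let L = PSL_n(q) where q = p^3 for a prime p, and suppose n = u·w is a product of two distinct odd primes u and w with n ≡ −1 (mod 3). Then the solvable graph S(L) is not a split graph. -/
/-- A nontrivial finite solvable group has a nontrivial normal subgroup that is elementary
abelian. -/
theorem exists_normal_elementary_abelian (G : Type*) [Group G] [Finite G] [Group.IsSolvable G]
    [Nontrivial G] :
    ∃ (t : ℕ) (T : Subgroup G), t.Prime ∧ T.Normal ∧ T ≠ ⊥ ∧
      (∀ x ∈ T, ∀ y ∈ T, x * y = y * x) ∧ ∀ x ∈ T, x ^ t = 1 := by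
  classical
  have hex : ∃ m, derivedSeries G m = ⊥ := (Group.isSolvable_def G).1 inferInstance
  obtain ⟨k, hk⟩ : ∃ k, Nat.find hex = k + 1 := by
    refine Nat.exists_eq_succ_of_ne_zero fun h0 => ?_
    have := Nat.find_spec hex
    rw [h0, derivedSeries_zero] at this
    exact top_ne_bot this
  have hA : derivedSeries G k ≠ ⊥ := Nat.find_min hex (by omega)
  have hcomm : ∀ x ∈ derivedSeries G k, ∀ y ∈ derivedSeries G k, x * y = y * x := by
    have h := Nat.find_spec hex
    rw [hk, derivedSeries_succ, Subgroup.commutator_eq_bot_iff_le_centralizer] at h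
    intro x hx y hy
    exact (Subgroup.mem_centralizer_iff.1 (h hx) y hy).symm
  have : Nontrivial (derivedSeries G k) := (Subgroup.nontrivial_iff_ne_bot _).2 hA
  have hcard : Nat.card (derivedSeries G k) ≠ 1 := Finite.one_lt_card.ne'
  have ht : (Nat.minFac (Nat.card (derivedSeries G k))).Prime := Nat.minFac_prime hcard
  set t := Nat.minFac (Nat.card (derivedSeries G k)) with htdef
  have : Fact t.Prime := ⟨ht⟩
  obtain ⟨g, hg⟩ := exists_prime_orderOf_dvd_card' (G := derivedSeries G k) t (Nat.minFac_dvd _)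
  let T : Subgroup G :=
    { carrier := {x | x ∈ derivedSeries G k ∧ x ^ t = 1}
      mul_mem' := by
        rintro x y ⟨hx, hx'⟩ ⟨hy, hy'⟩
        refine ⟨mul_mem hx hy, ?_⟩
        rw [(show Commute x y from hcomm x hx y hy).mul_pow, hx', hy', one_mul]
      one_mem' := ⟨one_mem _, one_pow _⟩
      inv_mem' := by
        rintro x ⟨hx, hx'⟩
        exact ⟨inv_mem hx, by rw [inv_pow, hx', inv_one]⟩ }
  refine ⟨t, T, ht, ⟨?_⟩, ?_, fun x hx y hy => hcomm x hx.1 y hy.1, fun x hx => hx.2⟩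
  · rintro x ⟨hx, hx'⟩ y
    exact ⟨(derivedSeries_normal G k).conj_mem x hx y, by rw [conj_pow, hx']; simp⟩
  · intro hbot
    have hgT : (g : G) ∈ T := by
      refine ⟨g.2, ?_⟩
      rw [← Subgroup.coe_pow, ← hg, pow_orderOf_eq_one, Subgroup.coe_one]
    rw [hbot, Subgroup.mem_bot, OneMemClass.coe_eq_one] at hgT
    rw [hgT, orderOf_one] at hg
    exact ht.one_lt.ne hg

/-- If every element of `T` satisfies `x ^ t = 1`, then `t` is the only prime that can divide the
order of `T`. -/
theorem Subgroup.prime_eq_of_dvd_card_of_pow_eq_one {G : Type*} [Group G] [Finite G]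
    {T : Subgroup G} {t r : ℕ} (ht : t.Prime) (hT : ∀ x ∈ T, x ^ t = 1) (hr : r.Prime)
    (h : r ∣ Nat.card T) : r = t := by
  have : Fact r.Prime := ⟨hr⟩
  obtain ⟨g, hg⟩ := exists_prime_orderOf_dvd_card' (G := T) r h
  have : orderOf g ∣ t := orderOf_dvd_of_pow_eq_one (Subtype.ext (hT g g.2))
  exact (Nat.prime_dvd_prime_iff_eq hr ht).1 (hg ▸ this)

/-- **Hall's theorem**: a finite solvable group has a Hall `π`-subgroup for every set `π` of
primes. -/
theorem exists_hall_subgroup (π : Set ℕ) (G : Type*) [Group G] [Finite G] [Group.IsSolvable G] :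
    ∃ L : Subgroup G, (∀ r : ℕ, r.Prime → r ∣ Nat.card L → r ∈ π) ∧
      ∀ r ∈ π, r.Prime → ¬ r ∣ L.index := by
  induction hm : Nat.card G using Nat.strong_induction_on generalizing G with
  | _ m ih =>
  rcases subsingleton_or_nontrivial G with hG | hG
  · refine ⟨⊤, fun r hr h => ?_, fun r _ hr h => ?_⟩
    · rw [Subgroup.card_top, Nat.card_of_subsingleton (1 : G), Nat.dvd_one] at h
      exact absurd h hr.ne_one
    · rw [Subgroup.index_top, Nat.dvd_one] at h
      exact hr.ne_one h
  obtain ⟨t, T, ht, hTn, hTbot, -, hTt⟩ := exists_normal_elementary_abelian G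
  have hT1 : 1 < Nat.card T := (Subgroup.one_lt_card_iff_ne_bot T).2 hTbot
  have hlt : Nat.card (G ⧸ T) < m := by
    rw [← hm, Subgroup.card_eq_card_quotient_mul_card_subgroup T]
    exact lt_mul_of_one_lt_right Nat.card_pos hT1
  obtain ⟨L, hL, hLi⟩ := ih _ hlt (G ⧸ T) rfl
  set M := L.comap (QuotientGroup.mk' T) with hMdef
  have hMi : M.index = L.index :=
    Subgroup.index_comap_of_surjective _ (QuotientGroup.mk'_surjective T)
  have hTM : T ≤ M := by
    intro x hx
    rw [hMdef, Subgroup.mem_comap, QuotientGroup.mk'_apply, (QuotientGroup.eq_one_iff x).2 hx]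
    exact one_mem L
  have hcardM : Nat.card M = Nat.card L * Nat.card T := by
    have h1 := M.card_mul_index
    have h2 := L.card_mul_index
    have h3 := Subgroup.card_eq_card_quotient_mul_card_subgroup T
    rw [hMi, h3, ← h2] at h1
    have : 0 < L.index := Nat.pos_of_ne_zero Subgroup.index_ne_zero_of_finite
    exact Nat.eq_of_mul_eq_mul_right this (by rw [h1]; ring)
  by_cases htπ : t ∈ π
  · refine ⟨M, fun r hr h => ?_, fun r hrπ hr => hMi ▸ hLi r hrπ hr⟩
    rw [hcardM, hr.dvd_mul] at h
    rcases h with h | h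
    · exact hL r hr h
    · rwa [Subgroup.prime_eq_of_dvd_card_of_pow_eq_one ht hTt hr h]
  · have hcardT : Nat.card (T.subgroupOf M) = Nat.card T :=
      Nat.card_congr (Subgroup.subgroupOfEquivOfLe hTM).toEquiv
    have hidx : (T.subgroupOf M).index = Nat.card L := by
      have h := (T.subgroupOf M).card_mul_index
      rw [hcardT, hcardM, mul_comm] at h
      exact Nat.eq_of_mul_eq_mul_right (by omega) h
    have hco : (Nat.card (T.subgroupOf M)).Coprime (T.subgroupOf M).index := by
      rw [hcardT, hidx]
      refine Nat.Coprime.symm (Nat.coprime_of_dvd fun r hr h1 h2 => htπ ?_)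
      rw [← Subgroup.prime_eq_of_dvd_card_of_pow_eq_one ht hTt hr h2]
      exact hL r hr h1
    obtain ⟨C, hC⟩ := Subgroup.exists_right_complement'_of_coprime hco
    have hcardC : Nat.card (C.map M.subtype) = Nat.card L := by
      rw [Subgroup.card_map_of_injective M.subtype_injective]
      have h := hC.card_mul_card
      rw [hcardT, hcardM, mul_comm] at h
      exact Nat.eq_of_mul_eq_mul_right (by omega) h
    have hidxC : (C.map M.subtype).index = L.index * Nat.card T := by
      have h1 := (C.map M.subtype).card_mul_index
      rw [hcardC, ← M.card_mul_index, hcardM, hMi] at h1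
      exact Nat.eq_of_mul_eq_mul_left (Nat.card_pos (α := L)) (by rw [h1]; ring)
    refine ⟨C.map M.subtype, fun r hr h => hL r hr (hcardC ▸ h), fun r hrπ hr h => ?_⟩
    rw [hidxC, hr.dvd_mul] at h
    rcases h with h | h
    · exact hLi r hrπ hr h
    · exact htπ (Subgroup.prime_eq_of_dvd_card_of_pow_eq_one ht hTt hr h ▸ hrπ)

/-- In a finite solvable group whose order is divisible by the distinct primes `a` and `c`, an
element of order one of these primes normalizes a nontrivial elementary abelian subgroup for the
other one. -/
theorem exists_normalized_elementary_abelian {K : Type*} [Group K] [Finite K] [Group.IsSolvable K]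
    {a c : ℕ} (ha : a.Prime) (hc : c.Prime) (hac : a ≠ c) (hak : a ∣ Nat.card K)
    (hck : c ∣ Nat.card K) :
    ∃ (r s : ℕ) (N : Subgroup K) (y : K), (r = a ∧ s = c ∨ r = c ∧ s = a) ∧ N ≠ ⊥ ∧
      (∀ x ∈ N, ∀ z ∈ N, x * z = z * x) ∧ (∀ x ∈ N, x ^ r = 1) ∧ orderOf y = s ∧
      ∀ x ∈ N, y * x * y⁻¹ ∈ N := by
  obtain ⟨L, hL, hLi⟩ := exists_hall_subgroup {a, c} K
  rw [← L.card_mul_index] at hak hck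
  have haL := (ha.dvd_mul.1 hak).resolve_right (hLi a (by simp) ha)
  have hcL := (hc.dvd_mul.1 hck).resolve_right (hLi c (by simp) hc)
  have : Nontrivial L := by
    rw [← Finite.one_lt_card_iff_nontrivial]
    exact ha.one_lt.trans_le (Nat.le_of_dvd Nat.card_pos haL)
  obtain ⟨t, T, ht, hTn, hTbot, hTc, hTt⟩ := exists_normal_elementary_abelian L
  have key : ∀ s : ℕ, s.Prime → s ∣ Nat.card L → ∃ (N : Subgroup K) (y : K), N ≠ ⊥ ∧
      (∀ x ∈ N, ∀ z ∈ N, x * z = z * x) ∧ (∀ x ∈ N, x ^ t = 1) ∧ orderOf y = s ∧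
      ∀ x ∈ N, y * x * y⁻¹ ∈ N := by
    intro s hs hsL
    have : Fact s.Prime := ⟨hs⟩
    obtain ⟨y, hy⟩ := exists_prime_orderOf_dvd_card' (G := L) s hsL
    refine ⟨T.map L.subtype, y, ?_, ?_, ?_, by rw [Subgroup.orderOf_coe, hy], ?_⟩
    · rwa [Ne, Subgroup.map_eq_bot_iff_of_injective _ L.subtype_injective]
    · rintro _ ⟨x, hx, rfl⟩ _ ⟨z, hz, rfl⟩
      exact congrArg L.subtype (hTc x hx z hz)
    · rintro _ ⟨x, hx, rfl⟩
      exact congrArg L.subtype (hTt x hx)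
    · rintro _ ⟨x, hx, rfl⟩
      exact ⟨y * x * y⁻¹, hTn.conj_mem x hx y, rfl⟩
  have htL : t ∈ ({a, c} : Set ℕ) := by
    refine hL t ht (dvd_trans ?_ (Subgroup.card_subgroup_dvd_card T))
    have hne : Nat.card T ≠ 1 := ((Subgroup.one_lt_card_iff_ne_bot T).2 hTbot).ne'
    have := Subgroup.prime_eq_of_dvd_card_of_pow_eq_one ht hTt (Nat.minFac_prime hne)
      (Nat.minFac_dvd _)
    exact this ▸ Nat.minFac_dvd _
  rcases htL with rfl | rfl
  · obtain ⟨N, y, h⟩ := key c hc hcL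
    exact ⟨t, c, N, y, Or.inl ⟨rfl, rfl⟩, h⟩
  · obtain ⟨N, y, h⟩ := key a ha haL
    exact ⟨t, a, N, y, Or.inr ⟨rfl, rfl⟩, h⟩

section Linear

variable {F V : Type*} [Field F] [AddCommGroup V] [Module F V]

/-- The subspace of vectors fixed by a linear automorphism. -/
def LinearEquiv.fixedSubmodule (f : V ≃ₗ[F] V) : Submodule F V :=
  LinearMap.eqLocus f.toLinearMap LinearMap.id

theorem LinearEquiv.mem_fixedSubmodule {f : V ≃ₗ[F] V} {v : V} :
    v ∈ f.fixedSubmodule ↔ f v = v := Iff.rfl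

theorem LinearEquiv.fixedSubmodule_ne_top {f : V ≃ₗ[F] V} (hf : f ≠ 1) :
    f.fixedSubmodule ≠ ⊤ := by
  intro h
  refine hf (LinearEquiv.ext fun v => ?_)
  exact LinearEquiv.mem_fixedSubmodule.1 (h ▸ Submodule.mem_top)

variable [Module.Finite F V]

open scoped IsMulCommutative in
/-- If `y` has prime order larger than `dim V` and normalizes an abelian group `N` containing an
element `x` that acts irreducibly, then `y` commutes with `x`. -/
theorem LinearEquiv.commute_of_normalizes {N : Subgroup (V ≃ₗ[F] V)}
    (hN : ∀ x ∈ N, ∀ z ∈ N, x * z = z * x) {x y : V ≃ₗ[F] V} (hxN : x ∈ N)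
    (hirr : ∀ W : Submodule F V, (∀ v ∈ W, x v ∈ W) → W = ⊥ ∨ W = ⊤)
    {c : ℕ} (hc : c.Prime) (hy : orderOf y = c) (hcn : Module.finrank F V < c)
    (hyN : ∀ x ∈ N, y * x * y⁻¹ ∈ N) [Nontrivial V] : Commute x y := by
  classical
  by_contra hxy
  let S : Set (Module.End F V) := (fun z : V ≃ₗ[F] V => (z : Module.End F V)) '' N
  have hS : ∀ s ∈ S, ∀ t ∈ S, s * t = t * s := by
    rintro _ ⟨s, hs, rfl⟩ _ ⟨t, ht, rfl⟩
    exact congrArg (fun z : V ≃ₗ[F] V => (z : Module.End F V)) (hN s hs t ht)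
  let E := Algebra.adjoin F S
  have : IsMulCommutative E := Algebra.isMulCommutative_adjoin F hS
  have hxE : (x : Module.End F V) ∈ E := Algebra.subset_adjoin ⟨x, hxN, rfl⟩
  have hker : ∀ T : E, T ≠ 0 → LinearMap.ker (T : Module.End F V) = ⊥ := by
    intro T hT
    have hTx : (T : Module.End F V) * x = x * T :=
      congrArg Subtype.val (mul_comm T (⟨x, hxE⟩ : E))
    refine (hirr _ fun v hv => ?_).resolve_right fun h => hT (Subtype.ext ?_)
    · have := LinearMap.congr_fun hTx v
      rw [Module.End.mul_apply, Module.End.mul_apply, LinearMap.mem_ker.1 hv, map_zero] at this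
      exact this
    · exact LinearMap.ker_eq_top.1 h
  have : NoZeroDivisors E := by
    refine ⟨fun {T S} hTS => or_iff_not_imp_left.2 fun hT => Subtype.ext (LinearMap.ext fun v => ?_)⟩
    have h : (T : Module.End F V) * S = 0 := congrArg Subtype.val hTS
    exact (Submodule.eq_bot_iff _).1 (hker T hT) _ (LinearMap.congr_fun h v)
  have : Nontrivial E := inferInstance
  have : IsDomain E := NoZeroDivisors.to_isDomain E
  have hmem : ∀ i : ℕ, y ^ i * x * (y ^ i)⁻¹ ∈ N := by
    intro i
    induction i with
    | zero => simpa using hxN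
    | succ i ih =>
      have := hyN _ ih
      rwa [show y * (y ^ i * x * (y ^ i)⁻¹) * y⁻¹ = y ^ (i + 1) * x * (y ^ (i + 1))⁻¹ by
        rw [pow_succ']; group] at this
  let z : ℕ → E := fun i => ⟨((y ^ i * x * (y ^ i)⁻¹ : V ≃ₗ[F] V) : Module.End F V),
    Algebra.subset_adjoin ⟨_, hmem i, rfl⟩⟩
  have hinj : Set.InjOn z (Finset.range c : Set ℕ) := by
    have aux : ∀ i j : ℕ, i < j → j < c → z i ≠ z j := by
      intro i j hij hj h
      have h' : y ^ i * x * (y ^ i)⁻¹ = y ^ j * x * (y ^ j)⁻¹ :=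
        LinearEquiv.toLinearMap_injective (congrArg Subtype.val h)
      obtain ⟨d, rfl⟩ := Nat.exists_eq_add_of_lt hij
      have hcomm : Commute x (y ^ (d + 1)) := by
        rw [add_assoc, pow_add] at h'
        have h2 : x = y ^ (d + 1) * x * (y ^ (d + 1))⁻¹ := by
          have := congrArg (fun t => (y ^ i)⁻¹ * t * y ^ i) h'
          simpa [mul_assoc] using this
        exact eq_mul_inv_iff_mul_eq.1 h2
      obtain ⟨m, hm⟩ := exists_pow_eq_self_of_coprime (x := y) (n := d + 1) (by
        rw [hy]
        exact (Nat.coprime_of_lt_prime (by omega) (by omega) hc).symm)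
      exact hxy (hm ▸ hcomm.pow_right m)
    intro i hi j hj h
    rw [Finset.mem_coe, Finset.mem_range] at hi hj
    rcases lt_trichotomy i j with hij | hij | hij
    · exact absurd h (aux i j hij hj)
    · exact hij
    · exact absurd h.symm (aux j i hij hi)
  let f : Polynomial F := LinearMap.charpoly (x : Module.End F V)
  have hf0 : f.map (algebraMap F E) ≠ 0 :=
    ((LinearMap.charpoly_monic (x : Module.End F V)).map _).ne_zero
  have hroot : ∀ i, (f.map (algebraMap F E)).IsRoot (z i) := by
    intro i
    rw [Polynomial.IsRoot, Polynomial.eval_map_algebraMap]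
    refine Subtype.ext ?_
    have hz : E.val (z i) = (y ^ i).conj (x : Module.End F V) := rfl
    have h := Polynomial.aeval_algHom_apply E.val (z i) f
    have hfi : f = ((y ^ i).conj (x : Module.End F V)).charpoly :=
      (LinearEquiv.charpoly_conj _ _).symm
    rw [hz, hfi, LinearMap.aeval_self_charpoly] at h
    rw [hfi]
    exact h.symm
  have hsub : (Finset.range c).image z ⊆ (f.map (algebraMap F E)).roots.toFinset := by
    intro t ht
    obtain ⟨i, -, rfl⟩ := Finset.mem_image.1 ht
    exact Multiset.mem_toFinset.2 ((Polynomial.mem_roots hf0).2 (hroot i))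
  have hcard := (Finset.card_le_card hsub).trans
    ((Multiset.toFinset_card_le _).trans (Polynomial.card_roots' _))
  rw [Finset.card_image_of_injOn hinj, Finset.card_range] at hcard
  have hdeg : (f.map (algebraMap F E)).natDegree ≤ Module.finrank F V :=
    Polynomial.natDegree_map_le.trans (LinearMap.charpoly_natDegree _).le
  omega

variable [Fintype F]

/-- If `f` has prime order `r`, then the codimension of the fixed space of `f` in an invariant
subspace is a multiple of the multiplicative order of `q` modulo `r`. -/
theorem LinearEquiv.orderOf_dvd_finrank_sub (f : V ≃ₗ[F] V) {r : ℕ} (hr : r.Prime)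
    (hf : f ^ r = 1) (hq : 0 < orderOf (Fintype.card F : ZMod r)) (W : Submodule F V)
    (hW : ∀ v ∈ W, f v ∈ W) :
    orderOf (Fintype.card F : ZMod r) ∣
      Module.finrank F W - Module.finrank F (W ⊓ f.fixedSubmodule : Submodule F V) := by
  classical
  have : Fact r.Prime := ⟨hr⟩
  have : Finite V := Module.finite_of_finite F
  have := Fintype.ofFinite V
  let g : Function.End W := fun v => ⟨f v, hW v v.2⟩
  have hg : ∀ (k : ℕ) (v : W), ((g ^ k) v : V) = (f ^ k) v := by
    intro k
    induction k with
    | zero => intro v; rfl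
    | succ k ih => intro v; rw [pow_succ, pow_succ]; exact ih (g v)
  have hg1 : g ^ r ^ 1 = 1 := by
    funext v
    refine Subtype.ext ?_
    rw [pow_one, hg, hf]
    rfl
  have hmod := Equiv.Perm.card_fixedPoints_modEq hg1
  have hfix : Fintype.card (Function.fixedPoints g) =
      Fintype.card (W ⊓ f.fixedSubmodule : Submodule F V) := by
    refine Fintype.card_congr ⟨fun v => ⟨v.1.1, v.1.2, congrArg Subtype.val v.2⟩,
      fun v => ⟨⟨v.1, v.2.1⟩, Subtype.ext v.2.2⟩, fun _ => rfl, fun _ => rfl⟩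
  have hle : Module.finrank F (W ⊓ f.fixedSubmodule : Submodule F V) ≤ Module.finrank F W :=
    Submodule.finrank_mono inf_le_left
  obtain ⟨d, hd⟩ := Nat.exists_eq_add_of_le hle
  rw [hfix, Module.card_eq_pow_finrank (K := F) (V := W),
    Module.card_eq_pow_finrank (K := F) (V := (W ⊓ f.fixedSubmodule : Submodule F V)),
    ← ZMod.natCast_eq_natCast_iff, hd] at hmod
  push_cast at hmod
  have hne : (Fintype.card F : ZMod r) ≠ 0 := by
    intro h0
    rw [h0, orderOf_pos_iff] at hq
    obtain ⟨k, hk, h⟩ := isOfFinOrder_iff_pow_eq_one.1 hq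
    rw [zero_pow hk.ne'] at h
    exact zero_ne_one h
  rw [pow_add, mul_eq_left₀ (pow_ne_zero _ hne)] at hmod
  rw [hd, Nat.add_sub_cancel_left]
  exact orderOf_dvd_of_pow_eq_one hmod

/-- If `q` has order `dim V` modulo the prime `a`, elements of order `a` act irreducibly. -/
theorem LinearEquiv.eq_bot_or_eq_top_of_invariant {x : V ≃ₗ[F] V} {a : ℕ} (ha : a.Prime)
    (hx : orderOf x = a) (hq : orderOf (Fintype.card F : ZMod a) = Module.finrank F V)
    (hn : 0 < Module.finrank F V) (W : Submodule F V) (hW : ∀ v ∈ W, x v ∈ W) :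
    W = ⊥ ∨ W = ⊤ := by
  have hxa : x ^ a = 1 := hx ▸ pow_orderOf_eq_one x
  have hx1 : x ≠ 1 := by
    rintro rfl
    rw [orderOf_one] at hx
    exact ha.one_lt.ne hx
  have hfix : x.fixedSubmodule = ⊥ := by
    have h := x.orderOf_dvd_finrank_sub ha hxa (hq ▸ hn) ⊤ fun _ _ => Submodule.mem_top
    rw [hq, top_inf_eq, finrank_top] at h
    have hlt := Submodule.finrank_lt (LinearEquiv.fixedSubmodule_ne_top hx1)
    have := Nat.le_of_dvd (by omega) h
    exact Submodule.finrank_eq_zero.1 (by omega)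
  have h := x.orderOf_dvd_finrank_sub ha hxa (hq ▸ hn) W hW
  rw [hq, hfix, inf_bot_eq, finrank_bot, Nat.sub_zero] at h
  rcases Nat.eq_zero_or_pos (Module.finrank F W) with h0 | h0
  · exact Or.inl (Submodule.finrank_eq_zero.1 h0)
  · exact Or.inr (Submodule.eq_top_of_finrank_eq
      (le_antisymm (Submodule.finrank_le W) (Nat.le_of_dvd h0 h)))

/-- If `q` has order `dim V - 1` modulo the prime `c`, elements of order `c` fix exactly a line. -/
theorem LinearEquiv.finrank_fixedSubmodule_eq_one {x : V ≃ₗ[F] V} {c : ℕ} (hc : c.Prime)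
    (hx : orderOf x = c) (hn : 3 ≤ Module.finrank F V)
    (hq : orderOf (Fintype.card F : ZMod c) = Module.finrank F V - 1) :
    Module.finrank F x.fixedSubmodule = 1 := by
  have hx1 : x ≠ 1 := by
    rintro rfl
    rw [orderOf_one] at hx
    exact hc.one_lt.ne hx
  have h := x.orderOf_dvd_finrank_sub hc (hx ▸ pow_orderOf_eq_one x) (by omega) ⊤
    fun _ _ => Submodule.mem_top
  rw [hq, top_inf_eq, finrank_top] at h
  have hlt := Submodule.finrank_lt (LinearEquiv.fixedSubmodule_ne_top hx1)
  obtain ⟨k, hk⟩ := h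
  have hk1 : k = 1 := by
    rcases k with _ | _ | k
    · omega
    · rfl
    · have : (Module.finrank F V - 1) * 2 ≤ (Module.finrank F V - 1) * (k + 1 + 1) :=
        Nat.mul_le_mul_left _ (by omega)
      omega
  subst hk1
  omega

/-- An automorphism of order `a` cannot commute with one of order `c`. -/
theorem LinearEquiv.not_commute_of_orderOf {x y : V ≃ₗ[F] V} {a c : ℕ} (ha : a.Prime)
    (hc : c.Prime) (hx : orderOf x = a) (hy : orderOf y = c) (hn : 3 ≤ Module.finrank F V)
    (hqa : orderOf (Fintype.card F : ZMod a) = Module.finrank F V)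
    (hqc : orderOf (Fintype.card F : ZMod c) = Module.finrank F V - 1) : ¬ Commute x y := by
  intro hxy
  have h1 := LinearEquiv.finrank_fixedSubmodule_eq_one hc hy hn hqc
  rcases LinearEquiv.eq_bot_or_eq_top_of_invariant ha hx hqa (by omega) y.fixedSubmodule
    (fun v hv => by
      have : (y * x) v = (x * y) v := by rw [hxy.eq]
      rw [LinearEquiv.mul_apply, LinearEquiv.mul_apply, LinearEquiv.mem_fixedSubmodule.1 hv] at this
      exact this) with h | h
  · rw [h, finrank_bot] at h1
    omega
  · rw [h, finrank_top] at h1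
    omega

/-- An automorphism of order `a` cannot conjugate one of order `c` into its centralizer. -/
theorem LinearEquiv.not_commute_conj {x y : V ≃ₗ[F] V} {a c : ℕ} (ha : a.Prime)
    (hc : c.Prime) (hx : orderOf x = c) (hy : orderOf y = a) (hn : 3 ≤ Module.finrank F V)
    (hqa : orderOf (Fintype.card F : ZMod a) = Module.finrank F V)
    (hqc : orderOf (Fintype.card F : ZMod c) = Module.finrank F V - 1) :
    ¬ Commute (y * x * y⁻¹) x := by
  intro hcomm
  have h1 := LinearEquiv.finrank_fixedSubmodule_eq_one hc hx hn hqc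
  have hz : (y * x * y⁻¹) ^ c = 1 := by rw [conj_pow, ← hx, pow_orderOf_eq_one]; simp
  have hdvd := (y * x * y⁻¹).orderOf_dvd_finrank_sub hc hz (by omega) x.fixedSubmodule
    (fun v hv => by
      have : (x * (y * x * y⁻¹)) v = ((y * x * y⁻¹) * x) v := by rw [hcomm.eq]
      rw [LinearEquiv.mul_apply x, LinearEquiv.mul_apply _ x,
        LinearEquiv.mem_fixedSubmodule.1 hv] at this
      exact this)
  have hle : Module.finrank F
      (x.fixedSubmodule ⊓ (y * x * y⁻¹).fixedSubmodule : Submodule F V) ≤ _ :=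
    Submodule.finrank_mono (inf_le_left)
  rw [hqc, h1] at hdvd
  have hzero := Nat.eq_zero_of_dvd_of_lt hdvd (by omega)
  have heq := Submodule.eq_of_le_of_finrank_eq
    (inf_le_left : x.fixedSubmodule ⊓ (y * x * y⁻¹).fixedSubmodule ≤ _) (by omega)
  rcases LinearEquiv.eq_bot_or_eq_top_of_invariant (x := y⁻¹) ha (by rw [orderOf_inv, hy]) hqa
    (by omega) x.fixedSubmodule
    (fun v hv => by
      rw [← heq] at hv
      have hv2 : (y * x * y⁻¹) v = v := hv.2
      refine LinearEquiv.mem_fixedSubmodule.2 ?_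
      have : (y⁻¹ * (y * x * y⁻¹)) v = y⁻¹ v := by rw [LinearEquiv.mul_apply, hv2]
      rwa [← mul_assoc, ← mul_assoc, inv_mul_cancel, one_mul] at this) with h | h
  · rw [h, finrank_bot] at h1
    omega
  · rw [h, finrank_top] at h1
    omega

end Linear

/-- No solvable group of linear automorphisms has order divisible by both `a` and `c`, where `q` has
order `dim V` modulo `a` and order `dim V - 1` modulo `c`. -/
theorem not_dvd_card_of_solvable_of_injective {F V : Type*} [Field F] [Fintype F]
    [AddCommGroup V] [Module F V] [Module.Finite F V] {K : Type*} [Group K] [Finite K]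
    [Group.IsSolvable K] (φ : K →* (V ≃ₗ[F] V)) (hφ : Function.Injective φ) {a c : ℕ}
    (ha : a.Prime) (hc : c.Prime) (hn : 3 ≤ Module.finrank F V) (hcn : Module.finrank F V < c)
    (hqa : orderOf (Fintype.card F : ZMod a) = Module.finrank F V)
    (hqc : orderOf (Fintype.card F : ZMod c) = Module.finrank F V - 1)
    (hak : a ∣ Nat.card K) : ¬ c ∣ Nat.card K := by
  intro hck
  have hac : a ≠ c := by
    rintro rfl
    omega
  have : Nontrivial V := Module.nontrivial_of_finrank_pos (R := F) (by omega)
  obtain ⟨r, s, N, y, hrs, hNbot, hNc, hNr, hys, hyN⟩ :=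
    exists_normalized_elementary_abelian ha hc hac hak hck
  obtain ⟨x, hxN, hx1⟩ := N.bot_or_exists_ne_one.resolve_left hNbot
  have hr : r.Prime := by
    rcases hrs with h | h
    · exact h.1 ▸ ha
    · exact h.1 ▸ hc
  have : Fact r.Prime := ⟨hr⟩
  have hxr : orderOf (φ x) = r := by
    rw [orderOf_injective φ hφ]
    exact orderOf_eq_prime (hNr x hxN) hx1
  have hys' : orderOf (φ y) = s := by rw [orderOf_injective φ hφ, hys]
  rcases hrs with ⟨rfl, rfl⟩ | ⟨rfl, rfl⟩
  · refine LinearEquiv.not_commute_of_orderOf ha hc hxr hys' hn hqa hqc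
      (LinearEquiv.commute_of_normalizes (N := N.map φ) ?_ (Subgroup.mem_map_of_mem φ hxN)
        (LinearEquiv.eq_bot_or_eq_top_of_invariant ha hxr hqa (by omega)) hc hys' hcn ?_)
    · rintro _ ⟨u, hu, rfl⟩ _ ⟨v, hv, rfl⟩
      rw [← map_mul, hNc u hu v hv, map_mul]
    · rintro _ ⟨u, hu, rfl⟩
      exact ⟨y * u * y⁻¹, hyN u hu, by simp⟩
  · refine LinearEquiv.not_commute_conj ha hc hxr hys' hn hqa hqc ?_
    rw [← map_inv, ← map_mul, ← map_mul]
    exact Commute.map (hNc _ (hyN x hxN) x hxN) φ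

/-- The primes `a` and `c` are not adjacent in the solvable graph of `PSL_n(q)` if `q` has order `n`
modulo `a` and order `n - 1` modulo `c`. -/
theorem not_adj_solvableGraph_psl {F : Type*} [Field F] [Fintype F] {n a c : ℕ} (hn : 3 ≤ n)
    (hcn : n < c) (hqa : orderOf (Fintype.card F : ZMod a) = n)
    (hqc : orderOf (Fintype.card F : ZMod c) = n - 1) :
    ¬ (solvableGraph (Matrix.ProjectiveSpecialLinearGroup (Fin n) F)).Adj a c := by
  rintro ⟨-, ha, hc, H, hH, hdvd⟩
  classical
  let Z := Subgroup.center (Matrix.SpecialLinearGroup (Fin n) F)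
  let K := H.comap (QuotientGroup.mk' Z)
  have hsurj := QuotientGroup.mk'_surjective Z
  have hdvd' : Nat.card H ∣ Nat.card K := by
    have h := Subgroup.card_map_dvd (QuotientGroup.mk' Z) (H := K)
    rwa [Subgroup.map_comap_eq_self_of_surjective hsurj] at h
  have : Group.IsSolvable H := hH
  have : Group.IsSolvable (Z.subgroupOf K) := Group.isSolvable_of_comm fun x y =>
    Subtype.ext (Subtype.ext (Subgroup.mem_center_iff.1 x.2 _).symm)
  have : Group.IsSolvable K := by
    refine Group.isSolvable_of_ker_le_range (Z.subgroupOf K).subtype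
      ((QuotientGroup.mk' Z).subgroupComap H) fun x hx => ?_
    rw [Subgroup.range_subtype, Subgroup.mem_subgroupOf]
    exact (QuotientGroup.eq_one_iff _).1 (congrArg Subtype.val (MonoidHom.mem_ker.1 hx))
  let φ : K →* ((Fin n → F) ≃ₗ[F] (Fin n → F)) :=
    Matrix.SpecialLinearGroup.toLin'.comp K.subtype
  have hφ : Function.Injective φ :=
    Matrix.SpecialLinearGroup.toLin'_injective.comp K.subtype_injective
  have hfr : Module.finrank F (Fin n → F) = n := Module.finrank_fin_fun F
  refine not_dvd_card_of_solvable_of_injective φ hφ ha hc ?_ ?_ ?_ ?_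
    ((dvd_mul_right a c).trans (hdvd.trans hdvd')) ((dvd_mul_left c a).trans (hdvd.trans hdvd'))
  all_goals rwa [hfr]

/-- A matrix of order `m` coprime to `q - 1` yields an element of order `m` in `PSL_n(q)`. -/
theorem exists_orderOf_psl_eq {F : Type*} [Field F] [Fintype F] {n m : ℕ}
    (A : Matrix (Fin n) (Fin n) F) (hA : orderOf A = m)
    (hm : m.Coprime (Fintype.card F - 1)) (hm0 : m ≠ 0) :
    ∃ g : Matrix.ProjectiveSpecialLinearGroup (Fin n) F, orderOf g = m := by
  have hAm : A ^ m = 1 := hA ▸ pow_orderOf_eq_one A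
  have hdetm : A.det ^ m = 1 := by rw [← Matrix.det_pow, hAm, Matrix.det_one]
  have hunit : ∀ {r : F}, r ≠ 0 → r ^ (Fintype.card F - 1) = 1 := fun h =>
    FiniteField.pow_card_sub_one_eq_one _ h
  have hdet0 : A.det ≠ 0 := by
    intro h0
    rw [h0, zero_pow hm0] at hdetm
    exact zero_ne_one hdetm
  have hdet : A.det = 1 := by
    rw [← orderOf_eq_one_iff, ← Nat.dvd_one, ← hm]
    exact Nat.dvd_gcd (orderOf_dvd_of_pow_eq_one hdetm) (orderOf_dvd_of_pow_eq_one (hunit hdet0))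
  let g : Matrix.SpecialLinearGroup (Fin n) F := ⟨A, hdet⟩
  have hgm : g ^ m = 1 := Subtype.ext (by rw [Matrix.SpecialLinearGroup.coe_pow]; exact hAm)
  refine ⟨(g : Matrix.ProjectiveSpecialLinearGroup (Fin n) F), Nat.dvd_antisymm ?_ ?_⟩
  · refine orderOf_dvd_of_pow_eq_one ?_
    rw [← QuotientGroup.mk_pow, hgm, QuotientGroup.mk_one]
  · have h := pow_orderOf_eq_one (g : Matrix.ProjectiveSpecialLinearGroup (Fin n) F)
    set k := orderOf (g : Matrix.ProjectiveSpecialLinearGroup (Fin n) F)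
    rw [← QuotientGroup.mk_pow, QuotientGroup.eq_one_iff] at h
    obtain ⟨r, hr, hrg⟩ := Matrix.SpecialLinearGroup.mem_center_iff.1 h
    have hgk : A ^ k = Matrix.scalar (Fin n) r := by
      rw [hrg, Matrix.SpecialLinearGroup.coe_pow]
    have hpow : A ^ (k * (Fintype.card F - 1)) = 1 := by
      rw [pow_mul, hgk, ← map_pow]
      rcases Nat.eq_zero_or_pos n with rfl | hn
      · exact Subsingleton.elim _ _
      · rw [hunit, map_one]
        rintro rfl
        rw [Fintype.card_fin, zero_pow hn.ne'] at hr
        exact zero_ne_one hr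
    exact hm.dvd_of_dvd_mul_right (hA ▸ orderOf_dvd_of_pow_eq_one hpow)

/-- For `d ≤ n`, the group `PSL_n(q)` has an element of order `m` for every divisor `m` of `q ^ d - 1`
coprime to `q - 1`. -/
theorem exists_orderOf_psl_eq_of_dvd {F : Type*} [Field F] [Fintype F] {n d m : ℕ} (hd : 0 < d)
    (hdn : d ≤ n) (hm : m.Coprime (Fintype.card F - 1)) (hmd : m ∣ Fintype.card F ^ d - 1) :
    ∃ g : Matrix.ProjectiveSpecialLinearGroup (Fin n) F, orderOf g = m := by
  classical
  obtain ⟨p, hchar⟩ := CharP.exists F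
  have hp : Fact p.Prime := ⟨CharP.char_is_prime F p⟩
  have : NeZero d := ⟨hd.ne'⟩
  let E := FiniteField.Extension F p d
  have hfinE : Finite E := Module.finite_of_finite F
  have hcardU : Nat.card Eˣ = Fintype.card F ^ d - 1 := by
    rw [Nat.card_units, FiniteField.natCard_extension, Nat.card_eq_fintype_card]
  obtain ⟨ζ, hζ⟩ := IsCyclic.exists_ofOrder_eq_natCard (α := Eˣ)
  have hpos : 0 < Fintype.card F ^ d - 1 := hcardU ▸ Nat.card_pos
  obtain ⟨e, he⟩ := hmd
  have hm0 : m ≠ 0 := by rintro rfl; omega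
  have he0 : e ≠ 0 := by rintro rfl; omega
  have hζe : orderOf (ζ ^ e) = m := by
    rw [orderOf_pow_of_dvd he0 (by rw [hζ, hcardU, he]; exact dvd_mul_left _ _), hζ, hcardU, he]
    exact Nat.mul_div_cancel _ (Nat.pos_of_ne_zero he0)
  let ι := (Fin (n - d) → F)
  let ψ : E →* Module.End F (E × ι) :=
    { toFun := fun t => (LinearMap.mulLeft F t).prodMap LinearMap.id
      map_one' := by ext <;> simp
      map_mul' := fun s t => by ext <;> simp }
  have hψ : Function.Injective ψ := fun s t h => by
    have := congrArg Prod.fst (LinearMap.congr_fun h ((1 : E), (0 : ι)))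
    simpa [ψ] using this
  have hfr : Module.finrank F (E × ι) = n := by
    rw [Module.finrank_prod, FiniteField.finrank_extension, Module.finrank_fin_fun]
    omega
  let b := (Module.finBasis F (E × ι)).reindex (finCongr hfr)
  let M := LinearMap.toMatrixAlgEquiv b
  refine exists_orderOf_psl_eq (M (ψ ((ζ ^ e : Eˣ) : E))) ?_ hm hm0
  rw [show orderOf (M _) = _ from orderOf_injective M.toMulEquiv.toMonoidHom M.injective _,
    orderOf_injective ψ hψ, orderOf_units, hζe]

/-- A prime modulo which `q` has order `d > 1` is coprime to `q - 1`. -/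
theorem coprime_sub_one_of_orderOf {q a d : ℕ} (hq : 0 < q) (ha : a.Prime)
    (hqa : orderOf (q : ZMod a) = d) (hd : 1 < d) : a.Coprime (q - 1) := by
  rw [Nat.Prime.coprime_iff_not_dvd ha]
  intro h
  have h1 : (q : ZMod a) = 1 := by
    rw [← ZMod.natCast_eq_zero_iff, Nat.cast_sub hq, Nat.cast_one, sub_eq_zero] at h
    exact h
  rw [h1, orderOf_one] at hqa
  omega

theorem dvd_pow_sub_one_of_orderOf {q a d : ℕ} (hq : 0 < q)
    (hqa : orderOf (q : ZMod a) = d) : a ∣ q ^ d - 1 := by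
  rw [← ZMod.natCast_eq_zero_iff, Nat.cast_sub (Nat.pow_pos hq), Nat.cast_one, sub_eq_zero,
    Nat.cast_pow, ← hqa, pow_orderOf_eq_one]

/-- Primes modulo which `q` has the same order `d`, with `1 < d ≤ n`, are adjacent in the solvable
graph of `PSL_n(q)`. -/
theorem adj_solvableGraph_psl {F : Type*} [Field F] [Fintype F] {n d a b : ℕ} (ha : a.Prime)
    (hb : b.Prime) (hab : a ≠ b) (hd : 1 < d) (hdn : d ≤ n)
    (hqa : orderOf (Fintype.card F : ZMod a) = d)
    (hqb : orderOf (Fintype.card F : ZMod b) = d) :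
    (solvableGraph (Matrix.ProjectiveSpecialLinearGroup (Fin n) F)).Adj a b := by
  have hq : 0 < Fintype.card F := Fintype.card_pos
  obtain ⟨g, hg⟩ := exists_orderOf_psl_eq_of_dvd (F := F) (n := n) (m := a * b) (by omega) hdn
    ((coprime_sub_one_of_orderOf hq ha hqa hd).mul_left
      (coprime_sub_one_of_orderOf hq hb hqb hd))
    (((Nat.coprime_primes ha hb).2 hab).mul_dvd_of_dvd_of_dvd
      (dvd_pow_sub_one_of_orderOf hq hqa) (dvd_pow_sub_one_of_orderOf hq hqb))
  refine ⟨hab, ha, hb, Subgroup.zpowers g, ?_, by rw [Nat.card_zpowers, hg]⟩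
  exact Group.isSolvable_of_comm fun x y => mul_comm' x y

/-- The value at `x` of the `N`-th cyclotomic polynomial, as a natural number. -/
noncomputable def cyclotomicNat (N x : ℕ) : ℕ := ((Polynomial.cyclotomic N ℤ).eval (x : ℤ)).natAbs

theorem cast_cyclotomicNat {N x : ℕ} (hx : 1 < x) (R : Type*) [Ring R] :
    (cyclotomicNat N x : R) = (Polynomial.cyclotomic N R).eval (x : R) := by
  have hpos : 0 < (Polynomial.cyclotomic N ℤ).eval (x : ℤ) :=
    Polynomial.cyclotomic_pos' N (by exact_mod_cast hx)
  have h := Polynomial.cyclotomic.eval_apply (x : ℤ) N (Int.castRingHom R)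
  rw [eq_intCast, eq_intCast, Int.cast_natCast] at h
  rw [h, cyclotomicNat, ← Int.cast_natCast, Int.natAbs_of_nonneg hpos.le]

/-- A prime `r` dividing `Φ_N(x)`, where `N = r ^ k * m` with `r ∤ m`, is one modulo which `x` has
order `m`. -/
theorem orderOf_eq_of_dvd_cyclotomicNat {x r k m : ℕ} (hx : 1 < x) (hr : r.Prime) (hm : ¬ r ∣ m)
    (h : r ∣ cyclotomicNat (r ^ k * m) x) : orderOf (x : ZMod r) = m := by
  have : Fact r.Prime := ⟨hr⟩
  have : NeZero (m : ZMod r) := ⟨by rwa [Ne, ZMod.natCast_eq_zero_iff]⟩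
  rw [← ZMod.natCast_eq_zero_iff, cast_cyclotomicNat hx] at h
  exact (Polynomial.isRoot_cyclotomic_prime_pow_mul_iff_of_charP.1 h).eq_orderOf.symm

theorem dvd_sub_one_of_dvd_cyclotomicNat {x r k m : ℕ} (hx : 1 < x) (hr : r.Prime)
    (hm : ¬ r ∣ m) (h : r ∣ cyclotomicNat (r ^ k * m) x) : m ∣ r - 1 := by
  have : Fact r.Prime := ⟨hr⟩
  have hord := orderOf_eq_of_dvd_cyclotomicNat hx hr hm h
  rw [← hord]
  refine ZMod.orderOf_dvd_card_sub_one fun h0 => hm ?_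
  rw [h0, orderOf_zero] at hord
  exact hord ▸ dvd_zero r

/-- A prime dividing both `N` and `Φ_N(x)` divides `Φ_N(x)` only once. -/
theorem not_sq_dvd_cyclotomicNat {x r N : ℕ} (hx : 1 < x) (hr : r.Prime) (hN : 2 < N)
    (hrN : r ∣ N) : ¬ r ^ 2 ∣ cyclotomicNat N x := by
  intro hsq
  have : Fact r.Prime := ⟨hr⟩
  have hdvd : r ∣ cyclotomicNat N x := (dvd_pow_self r two_ne_zero).trans hsq
  obtain ⟨k, m, hm, hk⟩ := Nat.exists_eq_pow_mul_and_not_dvd (n := N) (by omega) r hr.ne_one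
  obtain ⟨k, rfl⟩ : ∃ j, k = j + 1 := by
    refine Nat.exists_eq_succ_of_ne_zero ?_
    rintro rfl
    rw [pow_zero, one_mul] at hk
    exact hm (hk ▸ hrN)
  rw [hk] at hdvd
  have hord := orderOf_eq_of_dvd_cyclotomicNat hx hr hm hdvd
  have hmr := dvd_sub_one_of_dvd_cyclotomicNat hx hr hm hdvd
  set d := r ^ k * m with hd
  have hNd : N = d * r := by rw [hk, hd]; ring
  have hd0 : 0 < d := Nat.pos_of_ne_zero (by rintro h; rw [h] at hNd; omega)
  have hprod : (x ^ d - 1) * cyclotomicNat N x ∣ (x ^ d) ^ r - 1 := by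
    have h := Polynomial.eval_dvd (x := (x : ℤ))
      (Polynomial.X_pow_sub_one_mul_cyclotomic_dvd_X_pow_sub_one_of_dvd ℤ (d := d) (n := N)
        (Nat.mem_properDivisors.2 ⟨⟨r, hNd⟩, by rw [hNd]; exact lt_mul_of_one_lt_right hd0 hr.one_lt⟩))
    rw [Polynomial.eval_mul, ← cast_cyclotomicNat hx ℤ] at h
    simp only [Polynomial.eval_sub, Polynomial.eval_pow, Polynomial.eval_X,
      Polynomial.eval_one] at h
    rw [← pow_mul, ← hNd, ← Int.natCast_dvd_natCast, Nat.cast_mul,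
      Nat.cast_sub (Nat.one_le_pow _ _ (by omega)), Nat.cast_sub (Nat.one_le_pow _ _ (by omega))]
    exact_mod_cast h
  have hy1 : 1 < x ^ d := Nat.one_lt_pow hd0.ne' hx
  have hrd : r ∣ x ^ d - 1 := by
    rw [← ZMod.natCast_eq_zero_iff, Nat.cast_sub hy1.le, Nat.cast_one, sub_eq_zero, Nat.cast_pow]
    exact orderOf_dvd_iff_pow_eq_one.1 (hord ▸ dvd_mul_left _ _)
  have hdvd2 : (x ^ d - 1) * r ^ 2 ∣ (x ^ d) ^ r - 1 := (mul_dvd_mul_left _ hsq).trans hprod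
  have hrx : ¬ r ∣ x ^ d := by
    intro h
    have := (Nat.dvd_sub h hrd)
    rw [Nat.sub_sub_self hy1.le, Nat.dvd_one] at this
    exact hr.ne_one this
  rcases hr.eq_two_or_odd' with rfl | hodd
  · have hm1 : m = 1 := Nat.dvd_one.1 hmr
    rw [hm1, mul_one] at hd
    obtain ⟨j, rfl⟩ : ∃ j, k = j + 1 := by
      refine Nat.exists_eq_succ_of_ne_zero ?_
      rintro rfl
      omega
    have h4 : 4 ∣ x ^ d + 1 := by
      refine Nat.dvd_of_mul_dvd_mul_left (Nat.sub_pos_of_lt hy1) (hdvd2.trans (dvd_of_eq ?_))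
      rw [mul_comm, ← Nat.sq_sub_sq, one_pow]
    rw [hd, pow_succ, pow_mul, sq] at h4
    have : x ^ 2 ^ j % 4 < 4 := Nat.mod_lt _ (by norm_num)
    rw [Nat.dvd_iff_mod_eq_zero, Nat.add_mod, Nat.mul_mod] at h4
    interval_cases x ^ 2 ^ j % 4 <;> simp at h4
  · have hval := padicValNat.pow_sub_pow hodd hy1 hrd hrx hr.ne_zero
    rw [one_pow, padicValNat_self] at hval
    have hne : (x ^ d) ^ r - 1 ≠ 0 := by
      have := Nat.one_lt_pow hr.ne_zero hy1
      omega
    have hpow : r ^ (padicValNat r (x ^ d - 1) + 2) ∣ (x ^ d) ^ r - 1 := by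
      rw [pow_add]
      exact (mul_dvd_mul_right pow_padicValNat_dvd _).trans hdvd2
    have hle := (padicValNat_dvd_iff_le (p := r) hne).1 hpow
    omega

/-- `Φ_N(x)` exceeds every prime divisor of `N` that could divide it, unless `N` is small. -/
theorem lt_cyclotomicNat {x r N : ℕ} (hx : 1 < x) (hr : r.Prime) (hN : 6 < N) (hrN : r ∣ N)
    (hdvd : r ∣ cyclotomicNat N x) : r < cyclotomicNat N x := by
  have : Fact r.Prime := ⟨hr⟩
  obtain ⟨k, m, hm, hk⟩ := Nat.exists_eq_pow_mul_and_not_dvd (n := N) (by omega) r hr.ne_one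
  obtain ⟨k, rfl⟩ : ∃ j, k = j + 1 := by
    refine Nat.exists_eq_succ_of_ne_zero ?_
    rintro rfl
    rw [pow_zero, one_mul] at hk
    exact hm (hk ▸ hrN)
  rw [hk] at hdvd
  have hord := orderOf_eq_of_dvd_cyclotomicNat hx hr hm hdvd
  have hmr := dvd_sub_one_of_dvd_cyclotomicNat hx hr hm hdvd
  have hm0 : 0 < m := Nat.pos_of_ne_zero (by rintro rfl; exact hm (dvd_zero r))
  have hlt2 : r - 1 < 2 ^ (r - 1) := Nat.lt_two_pow_self
  rcases (show x = 2 ∨ 3 ≤ x by omega) with rfl | hx3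
  · have hr2 : r ≠ 2 := by
      rintro rfl
      rw [show ((2 : ℕ) : ZMod 2) = 0 from rfl, orderOf_zero] at hord
      omega
    have hr3 : 3 ≤ r := by have := hr.two_le; omega
    have hlt : r < 2 ^ r - 1 := by
      have h1 : 2 ^ r = 2 * 2 ^ (r - 1) := by rw [← pow_succ', Nat.sub_add_cancel hr.one_le]
      omega
    rcases Nat.eq_zero_or_pos k with rfl | hkpos
    · have hexp := congrArg (Polynomial.eval (2 : ℝ))
        (Polynomial.cyclotomic_expand_eq_cyclotomic_mul hr hm ℝ)
      have hNm : m * r = N := by rw [hk]; ring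
      rw [Polynomial.expand_eval, Polynomial.eval_mul, hNm] at hexp
      have hcast := cast_cyclotomicNat (N := N) hx ℝ
      rw [Nat.cast_ofNat] at hcast
      rw [← hcast] at hexp
      by_contra! hle
      have hle' : (cyclotomicNat N 2 : ℝ) ≤ r := by exact_mod_cast hle
      have hr5 : 5 ≤ r := by
        by_contra! h5
        have h34 : r = 3 := by
          have : r ≠ 4 := by rintro rfl; exact absurd hr (by norm_num)
          omega
        subst h34
        have := Nat.le_of_dvd (by norm_num) hmr
        omega
      have hlow := Polynomial.sub_one_pow_totient_le_cyclotomic_eval (q := (2 : ℝ) ^ r)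
        (one_lt_pow₀ (by norm_num) hr.ne_zero) m
      have hup := Polynomial.cyclotomic_eval_le_add_one_pow_totient (q := (2 : ℝ)) (by norm_num) m
      have hφ : m.totient ≠ 0 := (Nat.totient_pos.2 hm0).ne'
      have hr1 : (1 : ℝ) ≤ r := by exact_mod_cast hr.one_le
      have hchain : ((2 : ℝ) ^ r - 1) ^ m.totient ≤ ((r : ℝ) * 3) ^ m.totient := by
        calc ((2 : ℝ) ^ r - 1) ^ m.totient
            ≤ cyclotomicNat N 2 * (Polynomial.cyclotomic m ℝ).eval 2 := hlow.trans_eq hexp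
          _ ≤ r * (2 + 1) ^ m.totient := by
              refine mul_le_mul hle' hup ?_ (by positivity)
              exact (Polynomial.cyclotomic_pos' m (by norm_num)).le
          _ ≤ r ^ m.totient * 3 ^ m.totient := by
              rw [show (2 : ℝ) + 1 = 3 by norm_num]
              gcongr
              exact le_self_pow₀ hr1 hφ
          _ = _ := (mul_pow _ _ _).symm
      have hbase := le_of_pow_le_pow_left₀ hφ (by positivity) hchain
      have hbase' : 2 ^ r ≤ r * 3 + 1 := by
        have : (2 : ℝ) ^ r ≤ r * 3 + 1 := by linarith
        exact_mod_cast this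
      have hcontra : ∀ s : ℕ, 5 ≤ s → s * 3 + 1 < 2 ^ s := by
        intro s hs
        induction s, hs using Nat.le_induction with
        | base => norm_num
        | succ s hs ih => rw [pow_succ]; omega
      exact absurd hbase' (not_le.2 (hcontra r hr5))
    · have hdiv : r ∣ r ^ k * m := (dvd_pow_self r hkpos.ne').mul_right m
      have hexp := congrArg (Polynomial.eval (2 : ℤ))
        (Polynomial.cyclotomic_expand_eq_cyclotomic hr hdiv ℤ)
      have hNm : r ^ k * m * r = N := by rw [hk]; ring
      rw [Polynomial.expand_eval, hNm] at hexp
      have h1 : 1 < r ^ k * m :=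
        hr.one_lt.trans_le (Nat.le_of_dvd (by positivity) hdiv)
      have hlow := Polynomial.sub_one_lt_natAbs_cyclotomic_eval (q := 2 ^ r) h1 (by omega)
      have heq : cyclotomicNat N 2 = ((Polynomial.cyclotomic (r ^ k * m) ℤ).eval
          (((2 ^ r : ℕ)) : ℤ)).natAbs := by
        rw [cyclotomicNat, Nat.cast_ofNat, ← hexp]
        push_cast
        rfl
      rw [heq]
      exact hlt.trans hlow
  · have hlow : (x - 1) ^ N.totient < cyclotomicNat N x :=
      Polynomial.sub_one_pow_totient_lt_natAbs_cyclotomic_eval (by omega) (by omega)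
    have htot : r - 1 ≤ N.totient := by
      rw [← Nat.totient_prime hr]
      exact Nat.le_of_dvd (Nat.totient_pos.2 (by omega)) (Nat.totient_dvd_of_dvd hrN)
    have h2 : 2 ^ (r - 1) ≤ (x - 1) ^ N.totient :=
      (Nat.pow_le_pow_left (by omega) _).trans (Nat.pow_le_pow_right (by omega) htot)
    omega

/-- **Zsigmondy's theorem** for `x ^ N - 1` with `N > 6`: there is a prime modulo which `x` has
order exactly `N`. -/
theorem exists_prime_orderOf_eq {x N : ℕ} (hx : 1 < x) (hN : 6 < N) :
    ∃ r : ℕ, r.Prime ∧ orderOf (x : ZMod r) = N := by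
  by_contra! hcon
  have hdvdN : ∀ r : ℕ, r.Prime → r ∣ cyclotomicNat N x → r ∣ N := by
    intro r hr hdvd
    by_contra hrN
    refine hcon r hr (orderOf_eq_of_dvd_cyclotomicNat (k := 0) hx hr hrN ?_)
    rwa [pow_zero, one_mul]
  have hlt : ∀ r s : ℕ, r.Prime → s.Prime → r ≠ s → r ∣ cyclotomicNat N x →
      s ∣ cyclotomicNat N x → s < r := by
    intro r s hr hs hne hrd hsd
    obtain ⟨k, m, hm, hk⟩ := Nat.exists_eq_pow_mul_and_not_dvd (n := N) (by omega) r hr.ne_one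
    have hsN := hdvdN s hs hsd
    rw [hk] at hrd hsN
    have hmr := dvd_sub_one_of_dvd_cyclotomicNat hx hr hm hrd
    have hsm : s ∣ m := (hs.dvd_mul.1 hsN).resolve_left fun h =>
      hne ((Nat.prime_dvd_prime_iff_eq hs hr).1 (hs.dvd_of_dvd_pow h)).symm
    have h1 := hr.one_lt
    have := Nat.le_of_dvd (by omega) (hsm.trans hmr)
    omega
  have hA1 : 1 < cyclotomicNat N x := by
    have := Polynomial.sub_one_lt_natAbs_cyclotomic_eval (n := N) (q := x) (by omega) (by omega)
    rw [cyclotomicNat]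
    omega
  obtain ⟨r, hr, hrd⟩ := Nat.exists_prime_and_dvd hA1.ne'
  have hrN := hdvdN r hr hrd
  have hgt := lt_cyclotomicNat hx hr hN hrN hrd
  obtain ⟨B, hB⟩ := hrd
  have hB1 : B ≠ 1 := by rintro rfl; omega
  obtain ⟨s, hs, hsB⟩ := Nat.exists_prime_and_dvd hB1
  by_cases hsr : s = r
  · subst hsr
    refine not_sq_dvd_cyclotomicNat hx hs (by omega) hrN ?_
    rw [hB, sq]
    exact mul_dvd_mul_left _ hsB
  · have hrd : r ∣ cyclotomicNat N x := ⟨B, hB⟩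
    have hsd : s ∣ cyclotomicNat N x := hB ▸ hsB.mul_left r
    exact lt_asymm (hlt r s hr hs (Ne.symm hsr) hrd hsd) (hlt s r hs hr hsr hsd hrd)

/-- For `e ≥ 7` prime to `3` there are two distinct primes modulo which `p ^ 3` has order `e`. -/
theorem exists_two_primes_orderOf_cube_eq {p e : ℕ} (hp : 1 < p) (he : 6 < e)
    (he3 : Nat.Coprime e 3) :
    ∃ a b : ℕ, a.Prime ∧ b.Prime ∧ a ≠ b ∧ orderOf ((p ^ 3 : ℕ) : ZMod a) = e ∧
      orderOf ((p ^ 3 : ℕ) : ZMod b) = e := by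
  obtain ⟨a, ha, hae⟩ := exists_prime_orderOf_eq hp he
  obtain ⟨b, hb, hbe⟩ := exists_prime_orderOf_eq hp (show 6 < e * 3 by omega)
  refine ⟨a, b, ha, hb, ?_, ?_, ?_⟩
  · rintro rfl
    omega
  · rw [Nat.cast_pow, orderOf_pow' _ three_ne_zero, hae, he3.gcd_eq_one, Nat.div_one]
  · rw [Nat.cast_pow, orderOf_pow' _ three_ne_zero, hbe, Nat.gcd_mul_left_left,
      Nat.mul_div_cancel _ (by norm_num)]

/-- A prime modulo which `q` has order `n - 1` exceeds `n`, when `n` is composite. -/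
theorem lt_of_orderOf_eq_sub_one {q n c : ℕ} (hc : c.Prime) (hn : ¬ n.Prime) (hn2 : 2 ≤ n)
    (h : orderOf (q : ZMod c) = n - 1) : n < c := by
  have : Fact c.Prime := ⟨hc⟩
  have h0 : (q : ZMod c) ≠ 0 := by
    intro h0
    rw [h0, orderOf_zero] at h
    omega
  have hdvd := ZMod.orderOf_dvd_card_sub_one h0
  rw [h] at hdvd
  have h1 := hc.one_lt
  have hle := Nat.le_of_dvd (by omega) hdvd
  have hne : n ≠ c := by
    rintro rfl
    exact hn hc
  omega

theorem SimpleGraph.Adj.mem_primeDivisors_solvableGraph {G : Type*} [Group G] {r s : ℕ}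
    (h : (solvableGraph G).Adj r s) : r ∈ {r : ℕ | r.Prime ∧ r ∣ Nat.card G} := by
  obtain ⟨-, hr, -, H, -, hdvd⟩ := h
  exact ⟨hr, (dvd_mul_right r s).trans (hdvd.trans (Subgroup.card_subgroup_dvd_card H))⟩

/-- A graph with two edges that are joined by no further edge is not split. -/
theorem SimpleGraph.not_isSplit_of_two_edges {V : Type*} {Γ : SimpleGraph V} {S : Set V}
    {a b c d : V} (haS : a ∈ S) (hbS : b ∈ S) (hcS : c ∈ S) (hdS : d ∈ S) (hab : Γ.Adj a b)
    (hcd : Γ.Adj c d) (hcross : ∀ x ∈ ({a, b} : Set V), ∀ y ∈ ({c, d} : Set V),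
      x ≠ y ∧ ¬ Γ.Adj x y) : ¬ Γ.IsSplit S := by
  rintro ⟨C, I, hCI, -, hC, hI⟩
  have hedge : ∀ x ∈ S, ∀ y ∈ S, Γ.Adj x y → ∃ z ∈ ({x, y} : Set V), z ∈ C := by
    intro x hx y hy hxy
    by_contra! hcon
    rw [← hCI] at hx hy
    exact hI (hx.resolve_left (hcon x (by simp))) (hy.resolve_left (hcon y (by simp))) hxy.ne hxy
  obtain ⟨x, hx, hxC⟩ := hedge a haS b hbS hab
  obtain ⟨y, hy, hyC⟩ := hedge c hcS d hdS hcd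
  exact (hcross x hx y hy).2 (hC hxC hyC (hcross x hx y hy).1)

/-- for `L = PSL_n(q)` with `q = p ^ 3` and `n = u * w` a product of
two distinct odd primes with `n ≡ -1 (mod 3)`, the solvable graph of `L` is not split. -/
theorem solvableGraph_psl_not_split (p n u w : ℕ) (hp : p.Prime)
    (hu : u.Prime) (hw : w.Prime) (huw : u ≠ w) (hou : Odd u) (how : Odd w)
    (hn : n = u * w) (hmod : n % 3 = 2)
    (F : Type*) [Field F] [Fintype F] (hF : Fintype.card F = p ^ 3) :
    ¬ (solvableGraph (Matrix.ProjectiveSpecialLinearGroup (Fin n) F)).IsSplit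
      {r : ℕ | r.Prime ∧ r ∣ Nat.card (Matrix.ProjectiveSpecialLinearGroup (Fin n) F)} := by
  have hn15 : 15 ≤ n := by
    have hu2 : u ≠ 2 := by rintro rfl; exact absurd hou (by decide)
    have hw2 : w ≠ 2 := by rintro rfl; exact absurd how (by decide)
    have := hu.two_le
    have := hw.two_le
    obtain ⟨i, rfl⟩ := hou
    obtain ⟨j, rfl⟩ := how
    rcases lt_or_gt_of_ne huw with h | h
    · have := Nat.mul_le_mul (show 3 ≤ 2 * i + 1 by omega) (show 5 ≤ 2 * j + 1 by omega)
      omega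
    · have := Nat.mul_le_mul (show 5 ≤ 2 * i + 1 by omega) (show 3 ≤ 2 * j + 1 by omega)
      omega
  have hnp : ¬ n.Prime := hn ▸ Nat.not_prime_mul hu.ne_one hw.ne_one
  have hco : ∀ e : ℕ, e % 3 ≠ 0 → e.Coprime 3 := fun e he =>
    ((Nat.Prime.coprime_iff_not_dvd Nat.prime_three).2 fun h => he (Nat.mod_eq_zero_of_dvd h)).symm
  obtain ⟨a, b, ha, hb, hab, hqa, hqb⟩ :=
    exists_two_primes_orderOf_cube_eq hp.one_lt (show 6 < n by omega) (hco n (by omega))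
  obtain ⟨c, d, hc, hd, hcd, hqc, hqd⟩ :=
    exists_two_primes_orderOf_cube_eq hp.one_lt (show 6 < n - 1 by omega)
      (hco (n - 1) (by omega))
  rw [← hF] at hqa hqb hqc hqd
  have hadj_ab := adj_solvableGraph_psl ha hb hab (by omega) le_rfl hqa hqb
  have hadj_cd := adj_solvableGraph_psl (n := n) hc hd hcd (by omega) (by omega) hqc hqd
  refine SimpleGraph.not_isSplit_of_two_edges hadj_ab.mem_primeDivisors_solvableGraph
    hadj_ab.symm.mem_primeDivisors_solvableGraph hadj_cd.mem_primeDivisors_solvableGraph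
    hadj_cd.symm.mem_primeDivisors_solvableGraph hadj_ab hadj_cd ?_
  intro x hx y hy
  have hqx : orderOf (Fintype.card F : ZMod x) = n := by
    rcases hx with rfl | rfl <;> assumption
  have hqy : orderOf (Fintype.card F : ZMod y) = n - 1 := by
    rcases hy with rfl | rfl <;> assumption
  have hyp : y.Prime := by rcases hy with rfl | rfl <;> assumption
  refine ⟨?_, not_adj_solvableGraph_psl (by omega)
    (lt_of_orderOf_eq_sub_one hyp hnp (by omega) hqy) hqx hqy⟩
  rintro rfl
  omega
end
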